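/- arXiv:1805.06999 — 6 statements merged into one kernel-verified Lean document; each statement's English description precedes it below -/
import Mathlib

section
/- Let F be a finite field with q^2 elements and bar the automorphism x ↦ x^q. If A ∈ M_n(F) is similar (over F) to a Hermitian matrix (i.e., a matrix H with H = conjugate-transpose of H), then A is similar over F to a matrix with all entries in the subfield F_q of size q. -/
open Matrix
open Polynomial in
theorem exists_sigma (F : Type*) [Field F] [Fintype F] (q : ℕ)
    (hq : Fintype.card F = q ^ 2) :
    ∃ σ : F →+* F, (∀ x, σ x = x ^ q) ∧ (∀ x, σ (σ x) = x) ∧ ∃ θ, σ θ ≠ θ := by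
  obtain ⟨p, hp⟩ := CharP.exists F
  obtain ⟨m, hpp, hm⟩ := FiniteField.card F p
  have := Fact.mk hpp
  have hdvd : q ∣ p ^ (m : ℕ) := by rw [← hm, hq]; exact dvd_pow_self q two_ne_zero
  obtain ⟨k, -, hk⟩ := (Nat.dvd_prime_pow hpp).1 hdvd
  have h1 : 1 < q := by
    by_contra h
    have : 1 < q ^ 2 := by rw [← hq]; exact Fintype.one_lt_card
    have : q ^ 2 ≤ 1 ^ 2 := Nat.pow_le_pow_left (by omega) 2
    omega
  have hσ : ∀ x : F, iterateFrobenius F p k x = x ^ q := fun x => by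
    rw [iterateFrobenius_def, hk]
  refine ⟨iterateFrobenius F p k, hσ, fun x => ?_, ?_⟩
  · rw [hσ, hσ, ← pow_mul, ← sq, ← hq, FiniteField.pow_card]
  · by_contra! h
    have hne : (X ^ q - X : F[X]) ≠ 0 := FiniteField.X_pow_card_sub_X_ne_zero F h1
    have hd : (X ^ q - X : F[X]).natDegree = q := FiniteField.X_pow_card_sub_X_natDegree_eq F h1
    have : (Finset.univ : Finset F).card ≤ (X ^ q - X : F[X]).natDegree := by
      refine Polynomial.card_le_degree_of_subset_roots (p := X ^ q - X) (fun x _ => ?_)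
      rw [Polynomial.mem_roots hne]
      simp [← hσ, h]
    rw [hd, Finset.card_univ, hq] at this
    nlinarith

theorem descent {F : Type*} [Field F] {n : ℕ} (σ : F →+* F) (θ : F) (hθ : σ θ ≠ θ)
    (hσ : ∀ x, σ (σ x) = x) (H : Matrix (Fin n) (Fin n) F)
    (T : (Fin n → F) → (Fin n → F)) (Tadd : ∀ v w, T (v + w) = T v + T w)
    (Tsmul : ∀ (c : F) v, T (c • v) = σ c • T v) (TT : ∀ v, T (T v) = v)
    (TH : ∀ v, T (H *ᵥ v) = H *ᵥ T v) :
    ∃ B : Matrix (Fin n) (Fin n) F, (∀ i j, σ (B i j) = B i j) ∧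
      ∃ P : (Matrix (Fin n) (Fin n) F)ˣ, H = P.val * B * P⁻¹.val := by
  have hspan : ⊤ ≤ Submodule.span F {v : Fin n → F | T v = v} := by
    intro v _
    have h1 : v + T v ∈ Submodule.span F {v : Fin n → F | T v = v} :=
      Submodule.subset_span (by simp [Tadd, TT, add_comm])
    have h2 : θ • v + σ θ • T v ∈ Submodule.span F {v : Fin n → F | T v = v} :=
      Submodule.subset_span (by simp [Tadd, TT, Tsmul, hσ, add_comm])
    have h3 : v = (σ θ - θ)⁻¹ • (σ θ • (v + T v) - (θ • v + σ θ • T v)) := by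
      have : σ θ - θ ≠ 0 := sub_ne_zero.2 hθ
      rw [eq_inv_smul_iff₀ this]
      module
    rw [h3]
    exact Submodule.smul_mem _ _ (Submodule.sub_mem _ (Submodule.smul_mem _ _ h1) h2)
  let b0 := Module.Basis.ofSpan hspan
  have hb0 : ∀ i, T (b0 i) = b0 i := fun i => Module.Basis.ofSpan_subset hspan ⟨i, rfl⟩
  let b := b0.reindex (b0.indexEquiv (Pi.basisFun F (Fin n)))
  have hb : ∀ i, T (b i) = b i := fun i => by simp [b, hb0]
  let T' : (Fin n → F) →+ (Fin n → F) := AddMonoidHom.mk' T Tadd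
  have hT' : ∀ v, T' v = T v := fun _ => rfl
  refine ⟨LinearMap.toMatrix b b (Matrix.toLin' H), fun i j => ?_, ?_⟩
  · rw [LinearMap.toMatrix_apply, Matrix.toLin'_apply]
    set w := H *ᵥ b j with hw
    have hTw : T w = w := by rw [hw, TH, hb]
    have h : ∑ i, σ (b.repr w i) • b i = w := by
      conv_rhs => rw [← hTw, ← b.sum_repr w, ← hT', map_sum]
      simp only [hT', Tsmul, hb]
    conv_rhs => rw [← h]
    rw [b.repr_sum_self]
  · refine ⟨⟨(Pi.basisFun F (Fin n)).toMatrix b, b.toMatrix (Pi.basisFun F (Fin n)), by simp, by simp⟩, ?_⟩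
    show H = _ * _ * b.toMatrix (Pi.basisFun F (Fin n))
    rw [basis_toMatrix_mul_linearMap_toMatrix_mul_basis_toMatrix]
    simp

theorem exists_invol {ι α : Type*} [Finite ι] (q : ι → α) (s : α → α) (hs : ∀ a, s (s a) = a)
    (h : ∀ i, Nat.card {j // q j = q i} = Nat.card {j // q j = s (q i)}) :
    ∃ τ : ι → ι, (∀ i, τ (τ i) = i) ∧ ∀ i, q (τ i) = s (q i) := by
  let e : ∀ a, {i // q i = a} ≃ Fin (Nat.card {i // q i = a}) := fun a => Finite.equivFin _
  let idx : ι → ℕ := fun i => e (q i) ⟨i, rfl⟩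
  have hidx : ∀ a i (hi : q i = a), idx i = e a ⟨i, hi⟩ := by
    rintro _ i rfl; rfl
  have hinj : ∀ i j, q i = q j → idx i = idx j → i = j := by
    intro i j hq hi
    rw [hidx (q j) i hq, hidx (q j) j rfl] at hi
    simpa using (e (q j)).injective (Fin.ext hi)
  have hex : ∀ i, ∃ j, q j = s (q i) ∧ idx j = idx i := by
    intro i
    let k := (e (s (q i))).symm (Fin.cast (h i) (e (q i) ⟨i, rfl⟩))
    refine ⟨k.1, k.2, ?_⟩
    rw [hidx _ k.1 k.2]
    simp [k, idx]
  choose τ h1 h2 using hex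
  exact ⟨τ, fun i => hinj _ _ (by rw [h1, h1, hs]) (by rw [h2, h2]), h1⟩

theorem count_eq {ι : Type*} [Fintype ι] (v w : ι → ℕ)
    (h : ∀ e, ∑ i, min e (v i) = ∑ i, min e (w i)) (e : ℕ) :
    Nat.card {i // v i = e + 1} = Nat.card {i // w i = e + 1} := by
  have key : ∀ v : ι → ℕ, 2 * ∑ i, min (e + 1) (v i) =
      ∑ i, min e (v i) + ∑ i, min (e + 2) (v i) + Nat.card {i // v i = e + 1} := by
    intro v
    rw [Nat.card_eq_fintype_card, Fintype.card_subtype, Finset.card_filter, Finset.mul_sum,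
      ← Finset.sum_add_distrib, ← Finset.sum_add_distrib]
    refine Finset.sum_congr rfl fun i _ => ?_
    split_ifs <;> omega
  have h1 := key v
  have h2 := key w
  rw [h, h, h] at h1
  omega

open Polynomial in
theorem card_ker_quot {F : Type*} [Field F] [Fintype F] (d a b : F[X]) (hd : d ≠ 0) (ha : a ≠ 0)
    (hab : IsCoprime a b) :
    Nat.card {m : F[X] ⧸ Ideal.span {d * a} // (d * b) • m = 0} = Nat.card F ^ d.natDegree := by
  let L : F[X] →ₗ[F[X]] F[X] ⧸ Ideal.span {d * a} :=
    (Submodule.mkQ (Ideal.span {d * a})) ∘ₗ (LinearMap.mulLeft F[X] a)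
  have hL : ∀ g, L g = Ideal.Quotient.mk _ (a * g) := fun g => rfl
  have hker : LinearMap.ker L = Ideal.span {d} := by
    ext g
    rw [LinearMap.mem_ker, hL, Ideal.Quotient.eq_zero_iff_mem, Ideal.mem_span_singleton,
      Ideal.mem_span_singleton, mul_comm d a, mul_dvd_mul_iff_left ha]
  have hrange : ∀ m, m ∈ LinearMap.range L ↔ (d * b) • m = 0 := by
    intro m
    obtain ⟨g, rfl⟩ := Ideal.Quotient.mk_surjective m
    have : (d * b) • (Ideal.Quotient.mk (Ideal.span {d * a}) g) =
      Ideal.Quotient.mk (Ideal.span {d * a}) (d * b * g) := rfl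
    rw [this, Ideal.Quotient.eq_zero_iff_mem, Ideal.mem_span_singleton, mul_assoc,
      mul_dvd_mul_iff_left hd, LinearMap.mem_range]
    constructor
    · rintro ⟨k, hk⟩
      rw [hL, Ideal.Quotient.eq, Ideal.mem_span_singleton] at hk
      have h1 : a ∣ a * k - g := (Dvd.intro_left d rfl).trans hk
      have h2 : a ∣ g := (dvd_sub_right (Dvd.intro k rfl)).1 h1
      exact h2.mul_left b
    · intro h
      obtain ⟨k, rfl⟩ := hab.dvd_of_dvd_mul_left h
      exact ⟨k, rfl⟩
  have e1 : {m : F[X] ⧸ Ideal.span {d * a} // (d * b) • m = 0} ≃ LinearMap.range L :=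
    Equiv.subtypeEquivRight fun m => (hrange m).symm
  rw [Nat.card_congr e1, ← Nat.card_congr L.quotKerEquivRange.toEquiv, hker]
  have : Module.Finite F (F[X] ⧸ Ideal.span {d}) := (AdjoinRoot.powerBasis hd).finite
  have h := Module.natCard_eq_pow_finrank (K := F) (V := F[X] ⧸ Ideal.span {d})
  rw [finrank_quotient_span_eq_natDegree] at h
  exact h

open Polynomial in
theorem card_ker_pow {F : Type*} [Field F] [Fintype F] (p q : F[X]) (hp : Irreducible p)
    (hq : q ≠ 0) (e : ℕ) :
    Nat.card {m : F[X] ⧸ Ideal.span {q} // (p ^ e) • m = 0} =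
      Nat.card F ^ (p.natDegree * min e (multiplicity p q)) := by
  have hfin : FiniteMultiplicity p q := FiniteMultiplicity.of_not_isUnit hp.not_isUnit hq
  obtain ⟨a, ha, hpa⟩ := hfin.exists_eq_pow_mul_and_not_dvd
  set v := multiplicity p q
  clear_value v
  subst ha
  have ha0 : a ≠ 0 := right_ne_zero_of_mul hq
  have hcop : IsCoprime a p := ((Irreducible.coprime_iff_not_dvd hp).2 hpa).symm
  have h := card_ker_quot (p ^ (min e v)) (p ^ (v - min e v) * a) (p ^ (e - min e v))
    (pow_ne_zero _ hp.ne_zero) (mul_ne_zero (pow_ne_zero _ hp.ne_zero) ha0) (by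
      rcases le_total e v with h | h
      · rw [min_eq_left h, Nat.sub_self, pow_zero]; exact isCoprime_one_right
      · rw [min_eq_right h, Nat.sub_self, pow_zero, one_mul]; exact hcop.pow_right)
  rw [← mul_assoc, ← pow_add, ← pow_add, Nat.add_sub_cancel' (min_le_right _ _),
    Nat.add_sub_cancel' (min_le_left _ _)] at h
  rw [h, natDegree_pow, mul_comm]

open Polynomial in
theorem exists_T_pi {F : Type*} [Field F] (σ : F →+* F) (hσ : ∀ x, σ (σ x) = x)
    {ι : Type*} (q : ι → F[X]) (τ : ι → ι) (hτ : ∀ i, τ (τ i) = i)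
    (hq : ∀ i, q (τ i) = (q i).map σ) :
    ∃ T : (∀ i, F[X] ⧸ Ideal.span {q i}) → (∀ i, F[X] ⧸ Ideal.span {q i}),
      (∀ v w, T (v + w) = T v + T w) ∧ (∀ (f : F[X]) v, T (f • v) = (f.map σ) • T v) ∧
      ∀ v, T (T v) = v := by
  have hmm : ∀ f : F[X], (f.map σ).map σ = f := fun f => by
    ext; simp [hσ]
  let T : (∀ i, F[X] ⧸ Ideal.span {q i}) → (∀ i, F[X] ⧸ Ideal.span {q i}) := fun x i =>
    Ideal.quotientMap (Ideal.span {q i}) (mapRingHom σ) (by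
      rw [Ideal.span_singleton_le_iff_mem, Ideal.mem_comap, hq, coe_mapRingHom, hmm]
      exact Ideal.mem_span_singleton_self _) (x (τ i))
  have hT : ∀ g : ι → F[X], T (fun i => Ideal.Quotient.mk _ (g i)) =
      fun i => Ideal.Quotient.mk _ ((g (τ i)).map σ) := by
    intro g; funext i; simp [T]
  have hsurj : ∀ x : (∀ i, F[X] ⧸ Ideal.span {q i}), ∃ g : ι → F[X],
      x = fun i => Ideal.Quotient.mk _ (g i) := by
    intro x
    choose g hg using fun i => Ideal.Quotient.mk_surjective (x i)
    exact ⟨g, funext fun i => (hg i).symm⟩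
  refine ⟨T, fun v w => ?_, fun f v => ?_, fun v => ?_⟩
  · funext i; simp [T]
  · obtain ⟨g, rfl⟩ := hsurj v
    have : (f • (fun i => Ideal.Quotient.mk (Ideal.span {q i}) (g i)) : ∀ i, F[X] ⧸ Ideal.span {q i})
      = fun i => Ideal.Quotient.mk (Ideal.span {q i}) (f * g i) := rfl
    rw [this, hT g, hT (fun i => f * g i)]
    funext i
    rw [Polynomial.map_mul]
    rfl
  · obtain ⟨g, rfl⟩ := hsurj v
    rw [hT g, hT (fun i => (g (τ i)).map σ)]
    funext i
    rw [hτ, hmm]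

theorem card_ker_transpose {F : Type*} [Field F] [Fintype F] {n : ℕ}
    (N : Matrix (Fin n) (Fin n) F) :
    Nat.card {v : Fin n → F // Nᵀ *ᵥ v = 0} = Nat.card {v : Fin n → F // N *ᵥ v = 0} := by
  have key : ∀ N : Matrix (Fin n) (Fin n) F, Nat.card {v : Fin n → F // N *ᵥ v = 0} =
      Nat.card F ^ (n - N.rank) := by
    intro N
    have h := Module.natCard_eq_pow_finrank (K := F) (V := LinearMap.ker N.mulVecLin)
    have h2 := LinearMap.finrank_range_add_finrank_ker N.mulVecLin
    rw [Module.finrank_fin_fun] at h2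
    have h3 : n - N.rank = Module.finrank F (LinearMap.ker N.mulVecLin) := by
      rw [Matrix.rank]; omega
    rw [h3, ← h]
    rfl
  rw [key, key, Matrix.rank_transpose]

theorem card_ker_map {F : Type*} [Field F] [Fintype F] {n : ℕ} (σ : F →+* F)
    (hσ : ∀ x, σ (σ x) = x) (N : Matrix (Fin n) (Fin n) F) :
    Nat.card {v : Fin n → F // N.map σ *ᵥ v = 0} = Nat.card {v : Fin n → F // N *ᵥ v = 0} := by
  let e : (Fin n → F) ≃ (Fin n → F) :=
    ⟨fun v => σ ∘ v, fun v => σ ∘ v, fun v => by funext; simp [hσ], fun v => by funext; simp [hσ]⟩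
  refine (Nat.card_congr (e.subtypeEquiv fun v => ?_)).symm
  have : N.map σ *ᵥ (e v) = e (N *ᵥ v) := by
    funext i
    exact (RingHom.map_mulVec σ N v i).symm
  rw [this]
  constructor
  · intro h; rw [h]; funext; simp [e]
  · intro h; apply e.injective; rw [h]; funext; simp [e]

open Polynomial in
theorem card_ker_conj {F : Type*} [Field F] [Fintype F] {n : ℕ} (σ : F →+* F)
    (hσ : ∀ x, σ (σ x) = x) (H : Matrix (Fin n) (Fin n) F) (hH : (H.map σ)ᵀ = H) (f : F[X]) :
    Nat.card {v : Fin n → F // aeval H (f.map σ) *ᵥ v = 0} =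
      Nat.card {v : Fin n → F // aeval H f *ᵥ v = 0} := by
  have h1 : ∀ g : F[X], (aeval H g)ᵀ = aeval Hᵀ g := by
    intro g
    induction g using Polynomial.induction_on' with
    | add p q hp hq => simp [hp, hq]
    | monomial k c => simp [aeval_monomial, transpose_pow, Algebra.algebraMap_eq_smul_one]
  have h2 : (aeval H f).map σ = aeval (H.map σ) (f.map σ) := by
    have := Polynomial.hom_eval₂ f (algebraMap F (Matrix (Fin n) (Fin n) F)) (σ.mapMatrix) H
    rw [aeval_def, aeval_def, Polynomial.eval₂_map]
    refine this.trans ?_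
    congr 1
    ext c i j
    simp [Matrix.algebraMap_matrix_apply, apply_ite σ]
  have h3 : Hᵀ = H.map σ := by conv_lhs => rw [← hH, transpose_transpose]
  rw [← card_ker_transpose, h1, h3, ← h2, card_ker_map σ hσ]

open Polynomial in
theorem mult_eq_iff {F : Type*} [Field F] (p r : F[X]) (hp : Irreducible p) (hr : Irreducible r)
    (hpm : p.Monic) (hrm : r.Monic) (k e : ℕ) :
    r ^ k = p ^ (e + 1) ↔ multiplicity p (r ^ k) = e + 1 := by
  constructor
  · intro h
    rw [h]
    exact multiplicity_pow_self hp.ne_zero hp.not_isUnit _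
  · intro h
    have h1 : p ∣ r ^ k := by
      have h3 := pow_multiplicity_dvd p (r ^ k)
      rw [h] at h3
      exact (dvd_pow_self p (Nat.succ_ne_zero e)).trans h3
    have h2 : p = r := eq_of_monic_of_associated hpm hrm
      (hp.associated_of_dvd hr (hp.prime.dvd_of_dvd_pow h1))
    subst h2
    rw [multiplicity_pow_self hp.ne_zero hp.not_isUnit] at h
    rw [h]

open Polynomial in
theorem exists_T {F : Type*} [Field F] [Fintype F] {n : ℕ} (σ : F →+* F)
    (hσ : ∀ x, σ (σ x) = x) (H : Matrix (Fin n) (Fin n) F) (hH : (H.map σ)ᵀ = H) :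
    ∃ T : (Fin n → F) → (Fin n → F), (∀ v w, T (v + w) = T v + T w) ∧
    (∀ (c : F) v, T (c • v) = σ c • T v) ∧ (∀ v, T (T v) = v) ∧
    (∀ v, T (H *ᵥ v) = H *ᵥ T v) := by
  classical
  let φ : Module.End F (Fin n → F) := Matrix.toLin' H
  obtain ⟨ι, _, p, hp, k, ⟨E0⟩⟩ := Module.equiv_directSum_of_isTorsion (R := F[X])
    (M := Module.AEval' φ) (Module.AEval.isTorsion_of_finiteDimensional F (Fin n → F) φ)
  let r : ι → F[X] := fun i => normalize (p i)
  have hr : ∀ i, Irreducible (r i) := fun i => (normalize_associated (p i)).symm.irreducible (hp i)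
  have hrm : ∀ i, (r i).Monic := fun i => Polynomial.monic_normalize (hp i).ne_zero
  let q : ι → F[X] := fun i => r i ^ k i
  have hq0 : ∀ i, q i ≠ 0 := fun i => pow_ne_zero _ (hr i).ne_zero
  have hspan : ∀ i, Submodule.span F[X] {p i ^ k i} = Ideal.span {q i} := fun i =>
    Ideal.span_singleton_eq_span_singleton.2 ((normalize_associated (p i)).symm.pow_pow)
  let E1 : Module.AEval' φ ≃ₗ[F[X]] (∀ i, F[X] ⧸ Ideal.span {q i}) :=
    E0 ≪≫ₗ DirectSum.linearEquivFunOnFintype F[X] ι _ ≪≫ₗ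
      LinearEquiv.piCongrRight fun i => Submodule.quotEquivOfEq _ _ (hspan i)
  let E : (Fin n → F) ≃+ (∀ i, F[X] ⧸ Ideal.span {q i}) :=
    (Module.AEval'.of φ).toAddEquiv.trans E1.toAddEquiv
  have haev : ∀ f : F[X], aeval φ f = Matrix.toLin' (aeval H f) := fun f =>
    aeval_algHom_apply (Matrix.toLinAlgEquiv' : Matrix (Fin n) (Fin n) F ≃ₐ[F] _) H f
  have hE : ∀ (f : F[X]) v, E (aeval H f *ᵥ v) = f • E v := by
    intro f v
    have h1 : Module.AEval'.of φ (aeval H f *ᵥ v) = f • Module.AEval'.of φ v := by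
      have := Module.AEval.of_aeval_smul φ f v
      rw [haev] at this
      exact this
    show E1 (Module.AEval'.of φ (aeval H f *ᵥ v)) = f • E1 (Module.AEval'.of φ v)
    rw [h1, map_smul]
  have hcardM : ∀ f : F[X], Nat.card {v : Fin n → F // aeval H f *ᵥ v = 0} =
      ∏ i, Nat.card {m : F[X] ⧸ Ideal.span {q i} // f • m = 0} := by
    intro f
    rw [← Nat.card_pi]
    refine Nat.card_congr ((E.toEquiv.subtypeEquiv (q := fun x => ∀ i, f • x i = 0)
      fun v => ?_).trans (Equiv.subtypePiEquivPi
        (p := fun i (m : F[X] ⧸ Ideal.span {q i}) => f • m = 0)))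
    rw [← map_eq_zero_iff E E.injective, hE, funext_iff]
    rfl
  have hsum : ∀ s : F[X], Irreducible s → ∀ e, Nat.card {v : Fin n → F // aeval H (s ^ e) *ᵥ v = 0} =
      Nat.card F ^ (s.natDegree * ∑ i, min e (multiplicity s (q i))) := by
    intro s hs e
    rw [hcardM, Finset.mul_sum, ← Finset.prod_pow_eq_pow_sum]
    exact Finset.prod_congr rfl fun i _ => card_ker_pow s (q i) hs (hq0 i) e
  have hmm : ∀ f : F[X], (f.map σ).map σ = f := fun f => by
    ext; simp [hσ]
  let S : F[X] ≃+* F[X] := RingEquiv.ofRingHom (mapRingHom σ) (mapRingHom σ)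
    (RingHom.ext hmm) (RingHom.ext hmm)
  have hS : ∀ f, S f = f.map σ := fun _ => rfl
  have hirr : ∀ s : F[X], Irreducible s → Irreducible (s.map σ) := fun s hs => by
    rw [← hS]; exact (MulEquiv.irreducible_iff S).2 hs
  have hcount : ∀ i, Nat.card {j // q j = q i} = Nat.card {j // q j = (q i).map σ} := by
    intro i
    by_cases hk : k i = 0
    · simp [q, hk]
    · obtain ⟨e, he⟩ := Nat.exists_eq_succ_of_ne_zero hk
      have hqi : q i = r i ^ (e + 1) := by simp only [q]; rw [he]
      rw [hqi, Polynomial.map_pow]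
      have e1 : ∀ s : F[X], Irreducible s → s.Monic →
          Nat.card {j // q j = s ^ (e + 1)} = Nat.card {j // multiplicity s (q j) = e + 1} :=
        fun s hs hsm => Nat.card_congr (Equiv.subtypeEquivRight fun j =>
          mult_eq_iff s (r j) hs (hr j) hsm (hrm j) (k j) e)
      rw [e1 _ (hr i) (hrm i), e1 _ (hirr _ (hr i)) ((hrm i).map σ)]
      refine count_eq _ _ (fun e => ?_) e
      have h1 := hsum _ (hr i) e
      have h2 := hsum _ (hirr _ (hr i)) e
      rw [← Polynomial.map_pow, card_ker_conj σ hσ H hH, h1, natDegree_map] at h2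
      exact Nat.eq_of_mul_eq_mul_left (hr i).natDegree_pos
        (Nat.pow_right_injective (Finite.one_lt_card (α := F)) h2)
  obtain ⟨τ, hτ, hqτ⟩ := exists_invol q (fun f => f.map σ) hmm hcount
  obtain ⟨T, Ta, Ts, TT⟩ := exists_T_pi σ hσ q τ hτ hqτ
  have hT : ∀ (f : F[X]) v, E.symm (T (E (aeval H f *ᵥ v))) =
      aeval H (f.map σ) *ᵥ E.symm (T (E v)) := by
    intro f v
    apply E.injective
    rw [hE, hE, Ts, E.apply_symm_apply, E.apply_symm_apply]
  refine ⟨fun v => E.symm (T (E v)), fun v w => ?_, fun c v => ?_, fun v => ?_, fun v => ?_⟩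
  · simp [Ta]
  · have := hT (C c) v
    simpa [Algebra.algebraMap_eq_smul_one, Matrix.smul_mulVec] using this
  · simp [TT]
  · simpa using hT X v

/-- If a matrix over `F = 𝔽_{q²}` is similar to a Hermitian matrix (w.r.t. the
involution `x ↦ x^q`), then it is similar to a matrix with entries in `𝔽_q`. -/
theorem stmt0 (F : Type*) [Field F] [Fintype F] (q n : ℕ)
    (hq : Fintype.card F = q ^ 2)
    (A H : Matrix (Fin n) (Fin n) F)
    (hH : (H.map (· ^ q))ᵀ = H)
    (hsim : ∃ P : (Matrix (Fin n) (Fin n) F)ˣ, A = P.val * H * P⁻¹.val) :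
    ∃ B : Matrix (Fin n) (Fin n) F, (∀ i j, (B i j) ^ q = B i j) ∧
      ∃ P : (Matrix (Fin n) (Fin n) F)ˣ, A = P.val * B * P⁻¹.val := by
  obtain ⟨σ, h1, h2, θ, hθ⟩ := exists_sigma F q hq
  have hH' : (H.map σ)ᵀ = H := by
    rw [← funext h1] at hH
    exact hH
  obtain ⟨T, Ta, Ts, TT, TH⟩ := exists_T σ h2 H hH'
  obtain ⟨B, hB, Q, hQ⟩ := descent σ θ hθ h2 H T Ta Ts TT TH
  obtain ⟨P, hP⟩ := hsim
  refine ⟨B, fun i j => by rw [← h1, hB], P * Q, ?_⟩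
  rw [hP, hQ]
  simp [mul_assoc]
end

section
/- Let F be a finite field with q^2 elements. If A ∈ M_n(F) is similar over F to a matrix all of whose entries lie in the subfield F_q, then A is similar over F to a Hermitian matrix. -/
open Matrix

section Symm
open Polynomial

/-- A quotient of `K[X]` by a monic polynomial carries a Frobenius functional. -/
theorem exists_frobenius_functional_monic {K : Type*} [Field K] (f : K[X]) (hf : f.Monic) :
    ∃ l : (K[X] ⧸ Ideal.span {f}) →ₗ[K] K, ∀ a, (∀ b, l (a * b) = 0) → a = 0 := by
  refine ⟨(Polynomial.lcoeff K (f.natDegree - 1)).comp (AdjoinRoot.modByMonicHom hf), ?_⟩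
  intro a ha
  by_contra hne
  obtain ⟨g, rfl⟩ : ∃ g : K[X], AdjoinRoot.mk f (g %ₘ f) = a :=
    ⟨AdjoinRoot.modByMonicHom hf a, by
      obtain ⟨g, rfl⟩ := AdjoinRoot.mk_surjective (g := f) a
      rw [AdjoinRoot.modByMonicHom_mk, ← AdjoinRoot.modByMonicHom_mk hf (g %ₘ f),
        AdjoinRoot.mk_leftInverse hf, ← AdjoinRoot.modByMonicHom_mk hf,
        AdjoinRoot.mk_leftInverse hf]⟩
  have hr0 : g %ₘ f ≠ 0 := by
    intro h
    apply hne
    rw [h]; exact map_zero _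
  have hdeg : (g %ₘ f).degree < f.degree := degree_modByMonic_lt g hf
  have hnd : (g %ₘ f).natDegree < f.natDegree := natDegree_lt_natDegree hr0 hdeg
  set r := g %ₘ f with hr
  have h := ha (AdjoinRoot.mk f (X ^ (f.natDegree - 1 - r.natDegree)))
  have h2 : (AdjoinRoot.modByMonicHom hf
      (AdjoinRoot.mk f r * AdjoinRoot.mk f (X ^ (f.natDegree - 1 - r.natDegree)))).coeff
      (f.natDegree - 1) = 0 := h
  rw [← map_mul, AdjoinRoot.modByMonicHom_mk, (modByMonic_eq_self_iff hf).2] at h2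
  · rw [show f.natDegree - 1 = r.natDegree + (f.natDegree - 1 - r.natDegree) by omega] at h2
    rw [show r.natDegree + (f.natDegree - 1 - r.natDegree) - r.natDegree
      = f.natDegree - 1 - r.natDegree by omega, coeff_mul_X_pow] at h2
    exact hr0 (leadingCoeff_eq_zero.1 h2)
  · apply degree_lt_degree
    rw [natDegree_mul hr0 (pow_ne_zero _ X_ne_zero), natDegree_X_pow]
    omega

theorem exists_frobenius_functional {K : Type*} [Field K] (f : K[X]) (hf : f ≠ 0) :
    ∃ l : (K[X] ⧸ Ideal.span {f}) →ₗ[K] K, ∀ a, (∀ b, l (a * b) = 0) → a = 0 := by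
  classical
  have h : Ideal.span {f} = Ideal.span {normalize f} :=
    Ideal.span_singleton_eq_span_singleton.2 (associated_normalize f)
  rw [h]
  exact exists_frobenius_functional_monic _ (monic_normalize hf)

theorem exists_symm_form {K V : Type*} [Field K] [AddCommGroup V] [Module K V]
    [FiniteDimensional K V] (T : V →ₗ[K] V) :
    ∃ φ : LinearMap.BilinForm K V, (∀ x y, φ x y = φ y x) ∧ (∀ x y, φ (T x) y = φ x (T y)) ∧
      ∀ x, (∀ y, φ x y = 0) → x = 0 := by
  classical
  obtain ⟨ι, _, p, hp, e, ⟨E⟩⟩ := Module.equiv_directSum_of_isTorsion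
    (Module.AEval.isTorsion_of_finiteDimensional K V T)
  have hl : ∀ i, ∃ l : (K[X] ⧸ Ideal.span {p i ^ e i}) →ₗ[K] K,
      ∀ a, (∀ b, l (a * b) = 0) → a = 0 := fun i =>
    exists_frobenius_functional _ (pow_ne_zero _ (hp i).ne_zero)
  choose l hl using hl
  let g0 : ∀ i, Module.AEval K V T →ₗ[K[X]] (K[X] ⧸ Ideal.span {p i ^ e i}) := fun i =>
    (DirectSum.component K[X] ι (fun i => K[X] ⧸ Ideal.span {p i ^ e i}) i).comp E.toLinearMap
  let g : ∀ i, V →ₗ[K] (K[X] ⧸ Ideal.span {p i ^ e i}) := fun i =>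
    ((g0 i).restrictScalars K).comp (Module.AEval.of K V T).toLinearMap
  have hgT : ∀ i x, g i (T x) = Ideal.Quotient.mk _ X * g i x := by
    intro i x
    have : Module.AEval.of K V T (T x) = (X : K[X]) • Module.AEval.of K V T x := by
      rw [Module.AEval.X_smul_of]; rfl
    change g0 i (Module.AEval.of K V T (T x)) = _ * g0 i (Module.AEval.of K V T x)
    rw [this, map_smul]
    rfl
  refine ⟨∑ i, ((LinearMap.mul K (K[X] ⧸ Ideal.span {p i ^ e i})).compr₂ (l i)).compl₁₂
    (g i) (g i), ?_, ?_, ?_⟩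
  · intro x y
    simp [LinearMap.sum_apply, mul_comm]
  · intro x y
    simp only [LinearMap.sum_apply, LinearMap.compl₁₂_apply, LinearMap.compr₂_apply,
      LinearMap.mul_apply', hgT]
    refine Finset.sum_congr rfl fun i _ => ?_
    congr 1
    ring
  · intro x hx
    simp only [LinearMap.sum_apply, LinearMap.compl₁₂_apply, LinearMap.compr₂_apply,
      LinearMap.mul_apply'] at hx
    have key : ∀ i, g i x = 0 := by
      intro i
      apply hl i
      intro b
      have h := hx ((Module.AEval.of K V T).symm (E.symm
        (DirectSum.lof K[X] ι (fun i => K[X] ⧸ Ideal.span {p i ^ e i}) i b)))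
      have hg : ∀ j, g j ((Module.AEval.of K V T).symm (E.symm
        (DirectSum.lof K[X] ι (fun i => K[X] ⧸ Ideal.span {p i ^ e i}) i b))) =
          (DirectSum.lof K[X] ι (fun i => K[X] ⧸ Ideal.span {p i ^ e i}) i b) j := by
        intro j
        change (E ((Module.AEval.of K V T) ((Module.AEval.of K V T).symm (E.symm _)))) j = _
        rw [LinearEquiv.apply_symm_apply, LinearEquiv.apply_symm_apply]
      rw [Finset.sum_eq_single i] at h
      · rw [hg, DirectSum.lof_apply] at h
        exact h
      · intro j _ hj
        rw [hg, DirectSum.lof_eq_of, DirectSum.of_eq_of_ne _ _ _ hj, mul_zero, map_zero]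
      · simp
    have h1 : E (Module.AEval.of K V T x) = 0 := by
      ext i : 1
      exact key i
    rw [map_eq_zero_iff _ E.injective, map_eq_zero_iff _ (Module.AEval.of K V T).injective] at h1
    exact h1

theorem exists_symm_matrix {K : Type*} [Field K] {n : ℕ} (B : Matrix (Fin n) (Fin n) K) :
    ∃ S : Matrix (Fin n) (Fin n) K, S.det ≠ 0 ∧ Sᵀ = S ∧ S * B = Bᵀ * S := by
  obtain ⟨φ, hs, hT, hn⟩ := exists_symm_form (Matrix.toLin' B)
  refine ⟨LinearMap.BilinForm.toMatrix' φ, ?_, ?_, ?_⟩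
  · have h : φ.SeparatingLeft := hn
    exact Matrix.separatingLeft_iff_det_ne_zero.1
      (LinearMap.BilinForm.SeparatingLeft.toMatrix' h)
  · ext i j
    simp only [Matrix.transpose_apply, LinearMap.BilinForm.toMatrix'_apply]
    exact hs _ _
  · rw [LinearMap.BilinForm.toMatrix'_mul, LinearMap.BilinForm.mul_toMatrix', transpose_transpose]
    congr 1
    refine LinearMap.ext fun x => LinearMap.ext fun y => ?_
    exact (hT x y).symm

end Symm

section Herm

variable {F : Type*} [Field F] [StarRing F]

theorem exists_vec {n : ℕ} (ht : ∃ t : F, t + star t ≠ 0)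
    (hN : ∀ c : F, star c = c → ∃ a, star a * a = c)
    (M : Matrix (Fin n) (Fin n) F) (hM : Mᴴ = M) (h0 : M ≠ 0) :
    ∃ u : Matrix (Fin n) Unit F, uᴴ * M * u = 1 := by
  have hent : ∀ i j, star (M i j) = M j i := fun i j => by
    conv_rhs => rw [← hM]
    rfl
  have key : ∃ u : Matrix (Fin n) Unit F, (uᴴ * M * u) () () ≠ 0 := by
    by_cases hd : ∃ i, M i i ≠ 0
    · obtain ⟨i, hi⟩ := hd
      refine ⟨Matrix.of fun k _ => if k = i then 1 else 0, ?_⟩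
      simpa [Matrix.mul_apply, apply_ite star] using hi
    · push Not at hd
      obtain ⟨i, j, hij⟩ : ∃ i j, M i j ≠ 0 := by
        by_contra! h
        exact h0 (by ext i j; exact h i j)
      obtain ⟨t, ht⟩ := ht
      refine ⟨Matrix.of fun k _ => (if k = i then 1 else 0) + (if k = j then t / M i j else 0), ?_⟩
      have : M i j * (t / M i j) + star (M i j * (t / M i j)) ≠ 0 := by
        rwa [mul_div_cancel₀ _ hij]
      rw [star_mul, hent] at this
      simpa [Matrix.mul_apply, apply_ite star, add_mul, mul_add, Finset.sum_add_distrib, hd,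
        add_comm] using this
  obtain ⟨u, hu⟩ := key
  have hc : star ((uᴴ * M * u) () ()) = (uᴴ * M * u) () () := by
    have : (uᴴ * M * u)ᴴ = uᴴ * M * u := by
      simp [conjTranspose_mul, hM, Matrix.mul_assoc]
    exact congrFun (congrFun this ()) ()
  obtain ⟨a, ha⟩ := hN _ hc
  have ha0 : star a * a ≠ 0 := ha ▸ hu
  have ha1 : a ≠ 0 := right_ne_zero_of_mul ha0
  have ha2 : star a ≠ 0 := left_ne_zero_of_mul ha0
  refine ⟨a⁻¹ • u, ?_⟩
  ext ⟨⟩ ⟨⟩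
  rw [conjTranspose_smul, Matrix.smul_mul, Matrix.smul_mul, Matrix.mul_smul, Matrix.smul_apply,
    Matrix.smul_apply, ← ha, Matrix.one_apply_eq, star_inv₀]
  simp only [smul_eq_mul]
  field_simp

theorem exists_orthonormal {n : ℕ} (ht : ∃ t : F, t + star t ≠ 0)
    (hN : ∀ c : F, star c = c → ∃ a, star a * a = c)
    (S : Matrix (Fin n) (Fin n) F) (hS : Sᴴ = S) (h0 : S.det ≠ 0) (k : ℕ) (hk : k ≤ n) :
    ∃ P : Matrix (Fin n) (Fin k) F, Pᴴ * S * P = 1 := by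
  induction k with
  | zero => exact ⟨0, by ext i; exact i.elim0⟩
  | succ k ih =>
    obtain ⟨P, hP⟩ := ih (by omega)
    have hu : IsUnit S.det := isUnit_iff_ne_zero.2 h0
    have hM0 : S - S * P * Pᴴ * S ≠ 0 := by
      intro h
      have h1 : 1 = P * (Pᴴ * S) := by
        have h2 := congrArg (S⁻¹ * ·) (sub_eq_zero.1 h)
        simpa [Matrix.mul_assoc, Matrix.nonsing_inv_mul_cancel_left _ _ hu,
          Matrix.nonsing_inv_mul _ hu] using h2
      have h3 := Matrix.rank_mul_le_left P (Pᴴ * S)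
      rw [← h1, Matrix.rank_one, Fintype.card_fin] at h3
      have h4 := P.rank_le_width
      omega
    obtain ⟨u, hu1⟩ := exists_vec ht hN (S - S * P * Pᴴ * S)
      (by simp [conjTranspose_mul, hS, Matrix.mul_assoc]) hM0
    have hP' : Pᴴ * (S * P) = 1 := by rw [← Matrix.mul_assoc]; exact hP
    have hP'' : ∀ {m : Type} (Y : Matrix (Fin k) m F), Pᴴ * (S * (P * Y)) = Y := fun Y => by
      rw [← Matrix.mul_assoc S, ← Matrix.mul_assoc, hP', Matrix.one_mul]
    set w := u - P * (Pᴴ * (S * u)) with hw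
    have a1 : Pᴴ * (S * w) = 0 := by
      simp [hw, Matrix.mul_sub, hP'']
    have a2 : wᴴ * (S * P) = 0 := by
      have := congrArg conjTranspose a1
      simpa [conjTranspose_mul, hS, Matrix.mul_assoc] using this
    have a3 : wᴴ * (S * w) = 1 := by
      have : wᴴ * (S * w) = uᴴ * (S * w) := by
        conv_lhs => rw [hw]
        rw [conjTranspose_sub, Matrix.sub_mul, ← hw]
        simp [conjTranspose_mul, Matrix.mul_assoc, a1]
      rw [this, ← hu1, hw]
      simp [Matrix.mul_sub, Matrix.sub_mul, Matrix.mul_assoc]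
    refine ⟨(fromCols P w).submatrix id
      ((finSumFinEquiv.symm : Fin (k + 1) ≃ _).trans
        (Equiv.sumCongr (Equiv.refl _) (Equiv.ofUnique (Fin 1) Unit))), ?_⟩
    have hb : (fromCols P w)ᴴ * S * fromCols P w = 1 := by
      rw [conjTranspose_fromCols_eq_fromRows_conjTranspose, fromRows_mul, fromRows_mul_fromCols,
        Matrix.mul_assoc, Matrix.mul_assoc, Matrix.mul_assoc, Matrix.mul_assoc, hP', a1, a2, a3,
        fromBlocks_one]
    set ee := ((finSumFinEquiv.symm : Fin (k + 1) ≃ _).trans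
        (Equiv.sumCongr (Equiv.refl (Fin k)) (Equiv.ofUnique (Fin 1) Unit)))
    have := congrArg (fun Z => Z.submatrix ee ee) hb
    simp only [Matrix.submatrix_one_equiv] at this
    rw [← this]
    rfl

theorem herm_of_symm {n : ℕ} (ht : ∃ t : F, t + star t ≠ 0)
    (hN : ∀ c : F, star c = c → ∃ a, star a * a = c)
    (S B : Matrix (Fin n) (Fin n) F) (hS : Sᴴ = S) (h0 : S.det ≠ 0) (hSB : S * B = Bᴴ * S) :
    ∃ H : Matrix (Fin n) (Fin n) F, Hᴴ = H ∧
      ∃ P : (Matrix (Fin n) (Fin n) F)ˣ, B = P.val * H * P⁻¹.val := by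
  obtain ⟨P, hP⟩ := exists_orthonormal ht hN S hS h0 n le_rfl
  have hP2 : P * (Pᴴ * S) = 1 := mul_eq_one_comm.1 hP
  refine ⟨Pᴴ * S * B * P, ?_, ⟨P, Pᴴ * S, hP2, hP⟩, ?_⟩
  · simp only [conjTranspose_mul, conjTranspose_conjTranspose, hS, Matrix.mul_assoc]
    rw [← Matrix.mul_assoc Bᴴ, ← hSB, Matrix.mul_assoc]
  · change B = P * (Pᴴ * S * B * P) * (Pᴴ * S)
    rw [Matrix.mul_assoc, Matrix.mul_assoc _ P, hP2, Matrix.mul_one, ← Matrix.mul_assoc, hP2,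
      Matrix.one_mul]

end Herm

theorem norm_surj {F : Type*} [Field F] [Fintype F] (q : ℕ) (hq : Fintype.card F = q ^ 2)
    (c : F) (hc : c ^ q = c) : ∃ a : F, a ^ q * a = c := by
  classical
  have h2 : 1 < q := by
    have := Fintype.one_lt_card (α := F)
    by_contra h
    have : q = 0 ∨ q = 1 := by omega
    rcases this with rfl | rfl <;> omega
  by_cases h0 : c = 0
  · exact ⟨0, by simp [h0]⟩
  obtain ⟨g, hg⟩ := IsCyclic.exists_generator (α := Fˣ)
  obtain ⟨k, hk⟩ := (mem_powers_iff_mem_zpowers).2 (hg (Units.mk0 c h0))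
  have hk : g ^ k = Units.mk0 c h0 := hk
  have hord : orderOf g = (q + 1) * (q - 1) := by
    rw [orderOf_eq_card_of_forall_mem_zpowers hg, Nat.card_eq_fintype_card, Fintype.card_units, hq]
    obtain ⟨r, rfl⟩ : ∃ r, q = r + 1 := ⟨q - 1, by omega⟩
    simp only [Nat.add_sub_cancel]
    apply Nat.sub_eq_of_eq_add
    ring
  have h1 : g ^ (k * (q - 1)) = 1 := by
    rw [pow_mul, hk]
    ext
    simp only [Units.val_pow_eq_pow_val, Units.val_mk0, Units.val_one]
    apply mul_right_cancel₀ h0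
    rw [← pow_succ, Nat.sub_add_cancel h2.le, hc, one_mul]
  have h3 := orderOf_dvd_of_pow_eq_one h1
  rw [hord] at h3
  obtain ⟨m, rfl⟩ := Nat.dvd_of_mul_dvd_mul_right (by omega) h3
  refine ⟨(g : F) ^ m, ?_⟩
  have := congrArg Units.val hk
  simp only [Units.val_pow_eq_pow_val, Units.val_mk0] at this
  rw [← this]
  ring

theorem trace_ne {F : Type*} [Field F] [Fintype F] (q : ℕ) (hq : Fintype.card F = q ^ 2) :
    ∃ t : F, t + t ^ q ≠ 0 := by
  classical
  have h2 : 1 < q := by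
    have := Fintype.one_lt_card (α := F)
    by_contra h
    have : q = 0 ∨ q = 1 := by omega
    rcases this with rfl | rfl <;> omega
  by_contra! h
  have hd : (Polynomial.X ^ q + Polynomial.X : Polynomial F).natDegree = q := by
    rw [Polynomial.natDegree_add_eq_left_of_natDegree_lt] <;> simp [h2]
  have h0 : (Polynomial.X ^ q + Polynomial.X : Polynomial F) ≠ 0 := by
    intro h; rw [h] at hd; simp at hd; omega
  have := Polynomial.card_le_degree_of_subset_roots (p := Polynomial.X ^ q + Polynomial.X)
    (Z := (Finset.univ : Finset F)) (by
      intro x _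
      rw [Polynomial.mem_roots h0]
      simp [Polynomial.IsRoot, add_comm, h])
  rw [hd, Finset.card_univ, hq] at this
  nlinarith

/-- If a matrix over `F = 𝔽_{q²}` is similar to a matrix with entries in `𝔽_q`,
then it is similar to a Hermitian matrix (w.r.t. the involution `x ↦ x^q`). -/
theorem stmt1 (F : Type*) [Field F] [Fintype F] (q n : ℕ)
    (hq : Fintype.card F = q ^ 2)
    (A B : Matrix (Fin n) (Fin n) F)
    (hB : ∀ i j, (B i j) ^ q = B i j)
    (hsim : ∃ P : (Matrix (Fin n) (Fin n) F)ˣ, A = P.val * B * P⁻¹.val) :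
    ∃ H : Matrix (Fin n) (Fin n) F, (H.map (· ^ q))ᵀ = H ∧
      ∃ P : (Matrix (Fin n) (Fin n) F)ˣ, A = P.val * H * P⁻¹.val := by
  obtain ⟨σ, hσ⟩ : ∃ σ : F →+* F, ∀ x, σ x = x ^ q := by
    obtain ⟨p, hp, m, hpm⟩ := FiniteField.card' F
    have : Fact p.Prime := ⟨hpm.1⟩
    have hdvd : q ∣ p ^ (m : ℕ) := by
      rw [← hpm.2, hq]; exact dvd_pow_self q two_ne_zero
    obtain ⟨k, -, rfl⟩ := (Nat.dvd_prime_pow hpm.1).1 hdvd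
    exact ⟨iterateFrobenius F p k, fun x => rfl⟩
  letI : StarRing F :=
    { star := fun x => x ^ q
      star_involutive := fun x => by
        change (x ^ q) ^ q = x
        rw [← pow_mul, ← sq, ← hq, FiniteField.pow_card]
      star_mul := fun x y => by
        change (x * y) ^ q = y ^ q * x ^ q
        rw [mul_pow, mul_comm]
      star_add := fun x y => by
        change (x + y) ^ q = x ^ q + y ^ q
        rw [← hσ, map_add, hσ, hσ] }
  have hstar : ∀ x : F, star x = x ^ q := fun _ => rfl
  let K : Subfield F := σ.eqLocusField (RingHom.id F)
  have hK : ∀ x : K, (x : F) ^ q = x := fun x => by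
    rw [← hσ]; exact x.2
  let B' : Matrix (Fin n) (Fin n) K := Matrix.of fun i j => ⟨B i j, by
    change σ (B i j) = B i j
    rw [hσ, hB]⟩
  have hB' : B'.map K.subtype = B := by ext i j; rfl
  obtain ⟨S, h0, hs, hSB⟩ := exists_symm_matrix B'
  have hct : ∀ M : Matrix (Fin n) (Fin n) K, (M.map K.subtype)ᴴ = Mᵀ.map K.subtype := by
    intro M
    ext i j
    simp [hstar, hK]
  obtain ⟨H, hH, P, hP⟩ := herm_of_symm (trace_ne q hq) (norm_surj q hq) (S.map K.subtype) B
    (by rw [hct, hs])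
    (by
      have : (S.map K.subtype).det = K.subtype S.det := (RingHom.map_det K.subtype S).symm
      rw [this]
      exact (map_ne_zero K.subtype).2 h0)
    (by
      rw [← hB', hct, ← Matrix.map_mul, ← Matrix.map_mul, hSB])
  obtain ⟨R, hR⟩ := hsim
  refine ⟨H, ?_, R * P, ?_⟩
  · conv_rhs => rw [← hH]
    rfl
  · rw [hR, hP, _root_.mul_inv_rev]
    simp only [Units.val_mul, Matrix.mul_assoc]
end

section
/- For any field L and any square matrix B ∈ M_n(L), there exists an invertible symmetric matrix S ∈ GL_n(L) such that S·B = Bᵀ·S; consequently every square matrix over a field is similar to a symmetric matrix over some extension field. -/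
open Matrix

theorem aux_functional {K V : Type*} [Field K] [AddCommGroup V] [Module K V] (v w : V)
    (hv : v ≠ 0) (hw : w ≠ 0) : ∃ l : V →ₗ[K] K, l v ≠ 0 ∧ l w ≠ 0 := by
  have h1 : ∃ f : Module.Dual K V, f v ≠ 0 := by
    by_contra! h
    exact hv ((Module.forall_dual_apply_eq_zero_iff K v).1 h)
  have h2 : ∃ f : Module.Dual K V, f w ≠ 0 := by
    by_contra! h
    exact hw ((Module.forall_dual_apply_eq_zero_iff K w).1 h)
  obtain ⟨f, hf⟩ := h1
  obtain ⟨g, hg⟩ := h2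
  by_cases a : f w = 0
  · by_cases b : g v = 0
    · exact ⟨f + g, by simp [b, hf], by simp [a, hg]⟩
    · exact ⟨g, b, hg⟩
  · exact ⟨f, hf, a⟩

open Polynomial in
theorem aux_block {K : Type*} [Field K] (p : K[X]) (hp : Irreducible p) (e : ℕ) :
    ∃ l : (K[X] ⧸ Ideal.span {p ^ e}) →ₗ[K] K,
      (∀ f, f ≠ 0 → ∃ g, l (f * g) ≠ 0) ∧ ((∃ f : K[X] ⧸ Ideal.span {p ^ e}, f ≠ 0) → l 1 ≠ 0) := by
  rcases e with _ | e
  · have : Subsingleton (K[X] ⧸ Ideal.span {p ^ 0}) := by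
      rw [Ideal.Quotient.subsingleton_iff]; simp
    exact ⟨0, fun f hf => (hf (Subsingleton.elim _ _)).elim,
      fun ⟨f, hf⟩ => (hf (Subsingleton.elim _ _)).elim⟩
  have hne : (Ideal.Quotient.mk (Ideal.span {p ^ (e+1)}) (p ^ e)) ≠ 0 := by
    rw [Ne, Ideal.Quotient.eq_zero_iff_dvd]
    intro h
    have := (pow_dvd_pow_iff hp.ne_zero hp.not_isUnit).1 h
    omega
  have h1 : (1 : K[X] ⧸ Ideal.span {p ^ (e+1)}) ≠ 0 := by
    intro h
    apply hne
    rw [← mul_one (Ideal.Quotient.mk _ _), h, mul_zero]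
  obtain ⟨l, hl1, hl2⟩ := aux_functional (K := K) _ _ h1 hne
  refine ⟨l, ?_, fun _ => hl1⟩
  intro f hf
  obtain ⟨f, rfl⟩ := Ideal.Quotient.mk_surjective f
  rw [Ne, Ideal.Quotient.eq_zero_iff_dvd] at hf
  have hf0 : f ≠ 0 := by rintro rfl; simp at hf
  have hfin : FiniteMultiplicity p f := FiniteMultiplicity.of_not_isUnit hp.not_isUnit hf0
  obtain ⟨u, hu, hpu⟩ := hfin.exists_eq_pow_mul_and_not_dvd
  set j := multiplicity p f
  have hj : j ≤ e := by
    by_contra! h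
    exact hf (hu ▸ Dvd.dvd.mul_right (pow_dvd_pow p h) u)
  obtain ⟨a, b, hab⟩ := (hp.coprime_iff_not_dvd.2 hpu)
  refine ⟨Ideal.Quotient.mk _ (p ^ (e - j) * b), ?_⟩
  rw [← map_mul]
  convert hl2 using 2
  rw [Ideal.Quotient.eq, Ideal.mem_span_singleton]
  refine ⟨-a, ?_⟩
  have : p ^ e = p ^ j * p ^ (e - j) := by rw [← pow_add]; congr 1; omega
  rw [hu, pow_succ, this]
  linear_combination (p ^ j * p ^ (e - j)) * hab

open Polynomial in
theorem aux_form {K V : Type*} [Field K] [AddCommGroup V] [Module K V] [FiniteDimensional K V]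
    (T : V →ₗ[K] V) : ∃ β : V →ₗ[K] V →ₗ[K] K, (∀ x y, β x y = β y x) ∧
      (∀ x, x ≠ 0 → ∃ y, β x y ≠ 0) ∧ (∀ x y, β (T x) y = β x (T y)) ∧
      ((∃ x : V, x ≠ 0) → ∃ x, β x x ≠ 0) := by
  classical
  have hT : Module.IsTorsion K[X] (Module.AEval' T) :=
    Module.AEval.isTorsion_of_finiteDimensional K V T
  obtain ⟨ι, _, p, hp, e, ⟨φ⟩⟩ := Module.equiv_directSum_of_isTorsion hT
  choose l hl hl1 using fun i => aux_block (p i) (hp i) (e i)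
  let c : V → (i : ι) → K[X] ⧸ Ideal.span {p i ^ e i} := fun v i => φ (Module.AEval'.of T v) i
  have cadd : ∀ v w i, c (v + w) i = c v i + c w i := by
    intro v w i
    simp only [c, map_add]
    rfl
  have csmul : ∀ (f : K[X]) v i, c (aeval T f v) i = Ideal.Quotient.mk _ f * c v i := by
    intro f v i
    have : φ (Module.AEval'.of T (aeval T f v)) = f • φ (Module.AEval'.of T v) := by
      rw [← map_smul]; rfl
    simp only [c, this]
    obtain ⟨z, hz⟩ := Ideal.Quotient.mk_surjective (c v i)
    change f • (c v i) = Ideal.Quotient.mk _ f * c v i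
    rw [← hz]; rfl
  have cK : ∀ (k : K) v i, c (k • v) i = Ideal.Quotient.mk _ (C k) * c v i := by
    intro k v i
    have := csmul (C k) v i
    rwa [aeval_C, Module.algebraMap_end_apply] at this
  have lK : ∀ (k : K) i z, l i (Ideal.Quotient.mk _ (C k) * z) = k * l i z := by
    intro k i z
    rw [← smul_eq_mul k, ← map_smul]
    congr 1
    obtain ⟨z, rfl⟩ := Ideal.Quotient.mk_surjective z
    rw [← map_mul, ← smul_eq_C_mul]
    rfl
  have cT : ∀ v i, c (T v) i = Ideal.Quotient.mk _ X * c v i := by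
    intro v i
    have := csmul X v i
    rwa [aeval_X] at this
  have csurj : ∀ i z, ∃ v, c v i = z ∧ ∀ j, j ≠ i → c v j = 0 := by
    intro i z
    refine ⟨(Module.AEval'.of T).symm (φ.symm (DirectSum.of (fun i => K[X] ⧸ K[X] ∙ p i ^ e i) i z)), ?_, ?_⟩
    · simp only [c, LinearEquiv.apply_symm_apply]
      exact DirectSum.of_eq_same _ _
    · intro j hj
      simp only [c, LinearEquiv.apply_symm_apply]
      exact DirectSum.of_eq_of_ne _ _ _ hj
  have cinj : ∀ v, v ≠ 0 → ∃ i, c v i ≠ 0 := by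
    intro v hv
    by_contra! h
    apply hv
    have : φ (Module.AEval'.of T v) = 0 := DFinsupp.ext h
    simpa using this
  have key : ∀ i v w, (∀ j, j ≠ i → c w j = 0) →
      ∑ j, l j (c v j * c w j) = l i (c v i * c w i) := by
    intro i v w h
    apply Finset.sum_eq_single i
    · intro j _ hj; rw [h j hj]; simp
    · simp
  refine ⟨LinearMap.mk₂ K (fun v w => ∑ i, l i (c v i * c w i)) ?_ ?_ ?_ ?_, ?_, ?_, ?_, ?_⟩
  · intro x y z; simp [cadd, add_mul, Finset.sum_add_distrib]
  · intro x y z; simp [cK, lK, mul_assoc, Finset.mul_sum]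
  · intro x y z; simp [cadd, mul_add, Finset.sum_add_distrib]
  · intro x y z; simp [cK, lK, mul_left_comm (c _ _), Finset.mul_sum]
  · intro x y; simp [mul_comm]
  · intro x hx
    obtain ⟨i, hi⟩ := cinj x hx
    obtain ⟨g, hg⟩ := hl i _ hi
    obtain ⟨y, rfl, hy⟩ := csurj i g
    refine ⟨y, ?_⟩
    rw [LinearMap.mk₂_apply, key i x y hy]
    exact hg
  · intro x y
    simp only [LinearMap.mk₂_apply, cT]
    refine Finset.sum_congr rfl fun i _ => ?_
    congr 1; ring
  · rintro ⟨x, hx⟩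
    obtain ⟨i, hi⟩ := cinj x hx
    obtain ⟨y, hy1, hy⟩ := csurj i 1
    refine ⟨y, ?_⟩
    rw [LinearMap.mk₂_apply, key i y y hy, hy1, mul_one]
    exact hl1 i ⟨_, hi⟩

theorem aux_orth {K : Type*} [Field K] [IsAlgClosed K] (n : ℕ) :
    ∀ {V : Type _} [AddCommGroup V] [Module K V] [FiniteDimensional K V]
    (_ : Module.finrank K V = n) (β : V →ₗ[K] V →ₗ[K] K) (_ : ∀ x y, β x y = β y x)
    (_ : ∀ x, x ≠ 0 → ∃ y, β x y ≠ 0) (_ : (∃ x : V, x ≠ 0) → ∃ x, β x x ≠ 0),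
    ∃ v : Fin n → V, ∀ i j, β (v i) (v j) = if i = j then 1 else 0 := by
  induction n with
  | zero => intro V _ _ _ _ β _ _ _; exact ⟨Fin.elim0, fun i => i.elim0⟩
  | succ n ih =>
    intro V _ _ _ hV β hs hn ha
    -- normalised vector whose orthogonal complement is either zero or non-alternating
    have hnt : ∃ x : V, x ≠ 0 := by
      have : Nontrivial V := Module.nontrivial_of_finrank_pos (R := K) (by omega)
      exact exists_ne 0
    have hx : ∃ x, β x x = 1 := by
      obtain ⟨x, hx⟩ := ha hnt
      obtain ⟨s, hs⟩ := IsAlgClosed.exists_eq_mul_self (β x x)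
      have : s ≠ 0 := by rintro rfl; simp at hs; exact hx hs
      refine ⟨s⁻¹ • x, ?_⟩
      simp only [map_smul, LinearMap.smul_apply, smul_eq_mul, hs]
      field_simp
    have hproj : ∀ x, β x x = 1 → ∀ w, β x w = 0 → w ≠ 0 → ∃ y, β x y = 0 ∧ β w y ≠ 0 := by
      intro x hx w hw hw0
      obtain ⟨y, hy⟩ := hn w hw0
      refine ⟨y - β x y • x, by simp [hx], ?_⟩
      simpa [hs w x, hw] using hy
    have hx' : ∃ x, β x x = 1 ∧ ((∃ w, β x w = 0 ∧ w ≠ 0) → ∃ w, β x w = 0 ∧ β w w ≠ 0) := by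
      obtain ⟨x, hx⟩ := hx
      by_cases h : (∃ w, β x w = 0 ∧ w ≠ 0) → ∃ w, β x w = 0 ∧ β w w ≠ 0
      · exact ⟨x, hx, h⟩
      push Not at h
      obtain ⟨⟨u, hu, hu0⟩, halt⟩ := h
      obtain ⟨y, hxy, huy⟩ := hproj x hx u hu hu0
      have huu := halt u hu
      have hyy := halt y hxy
      refine ⟨x + u, ?_, fun _ => ⟨x - (β u y)⁻¹ • y, ?_, ?_⟩⟩
      · simp [hx, hu, hs u x, huu]
      · simp [hx, hs u x, hu, hxy, huy]
      · simp [hx, hs y x, hxy, hyy]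
    obtain ⟨x, hx, hw⟩ := hx'
    let W := LinearMap.ker (β x)
    have hsurj : Function.Surjective (β x) := fun k => ⟨k • x, by simp [hx]⟩
    have hW : Module.finrank K W = n := by
      have := LinearMap.finrank_range_add_finrank_ker (β x)
      rw [LinearMap.range_eq_top.2 hsurj, finrank_top, Module.finrank_self, hV] at this
      change Module.finrank K (LinearMap.ker (β x)) = n
      omega
    obtain ⟨v, hv⟩ := ih hW (β.domRestrict₁₂ W W) (fun a b => hs a b)
      (by
        rintro ⟨a, ha⟩ ha0
        obtain ⟨y, h1, h2⟩ := hproj x hx a ha (fun h => ha0 (Subtype.ext h))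
        exact ⟨⟨y, h1⟩, h2⟩)
      (by
        rintro ⟨⟨a, ha⟩, ha0⟩
        obtain ⟨w, h1, h2⟩ := hw ⟨a, ha, fun h => ha0 (Subtype.ext h)⟩
        exact ⟨⟨w, h1⟩, h2⟩)
    have hv' : ∀ i j, β (v i) (v j) = if i = j then 1 else 0 := hv
    have hxv : ∀ i, β x (v i) = 0 := fun i => (v i).2
    refine ⟨Fin.cons x (fun i => (v i : V)), ?_⟩
    intro i j
    cases i using Fin.cases <;> cases j using Fin.cases
    · simp [hx]
    · simp [hxv, (Fin.succ_ne_zero _).symm]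
    · simp [hs _ x, hxv]
    · simp [hv']

theorem aux_matrix {K : Type*} [Field K] (n : ℕ) (B : Matrix (Fin n) (Fin n) K)
    (β : (Fin n → K) →ₗ[K] (Fin n → K) →ₗ[K] K) (hs : ∀ x y, β x y = β y x)
    (hn : ∀ x, x ≠ 0 → ∃ y, β x y ≠ 0)
    (hB : ∀ x y, β (Matrix.toLin' B x) y = β x (Matrix.toLin' B y)) :
    ∃ S : Matrix (Fin n) (Fin n) K, Sᵀ = S ∧ IsUnit S ∧ S * B = Bᵀ * S ∧
      ∀ x y, β x y = x ⬝ᵥ S *ᵥ y := by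
  let S := LinearMap.toMatrix₂' K β
  have hS : ∀ x y, β x y = x ⬝ᵥ S *ᵥ y := by
    intro x y
    rw [← Matrix.toLinearMap₂'_apply', Matrix.toLinearMap₂'_toMatrix']
  refine ⟨S, ?_, ?_, ?_, hS⟩
  · ext i j
    simp [S, LinearMap.toMatrix₂'_apply, hs]
  · rw [Matrix.isUnit_iff_isUnit_det, isUnit_iff_ne_zero, ← Matrix.separatingLeft_iff_det_ne_zero,
      LinearMap.separatingLeft_toMatrix₂'_iff]
    intro x hx
    by_contra h
    obtain ⟨y, hy⟩ := hn x h
    exact hy (hx y)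
  · ext i j
    have := hB (Pi.single i 1) (Pi.single j 1)
    rw [hS, hS, Matrix.toLin'_apply, Matrix.toLin'_apply] at this
    rw [← Matrix.vecMul_transpose, ← Matrix.dotProduct_mulVec, Matrix.mulVec_mulVec,
      Matrix.mulVec_mulVec] at this
    simpa using this.symm

theorem stmt2 (L : Type*) [Field L] (n : ℕ) (B : Matrix (Fin n) (Fin n) L) :
    (∃ S : Matrix (Fin n) (Fin n) L, Sᵀ = S ∧ IsUnit S ∧ S * B = Bᵀ * S) ∧
    (∃ C : Matrix (Fin n) (Fin n) (AlgebraicClosure L), Cᵀ = C ∧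
      ∃ P : (Matrix (Fin n) (Fin n) (AlgebraicClosure L))ˣ,
        B.map (algebraMap L (AlgebraicClosure L)) = P.val * C * P⁻¹.val) := by
  constructor
  · obtain ⟨β, hs, hn, hB, -⟩ := aux_form (Matrix.toLin' B)
    obtain ⟨S, h1, h2, h3, -⟩ := aux_matrix n B β hs hn hB
    exact ⟨S, h1, h2, h3⟩
  · set A := B.map (algebraMap L (AlgebraicClosure L))
    obtain ⟨β, hs, hn, hB, ha⟩ := aux_form (Matrix.toLin' A)
    obtain ⟨S, h1, h2, h3, h4⟩ := aux_matrix n A β hs hn hB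
    obtain ⟨v, hv⟩ := aux_orth n (by simp) β hs hn ha
    let P : Matrix (Fin n) (Fin n) (AlgebraicClosure L) := Matrix.of fun i j => v j i
    have hP : Pᵀ * S * P = 1 := by
      ext i j
      rw [Matrix.mul_assoc, Matrix.one_apply, ← hv, h4]
      rfl
    have hP' : P * (Pᵀ * S) = 1 := mul_eq_one_comm.1 hP
    refine ⟨Pᵀ * S * A * P, ?_, ⟨P, Pᵀ * S, hP', hP⟩, ?_⟩
    · simp only [Matrix.transpose_mul, Matrix.transpose_transpose, h1, Matrix.mul_assoc]
      rw [← Matrix.mul_assoc S A, h3, Matrix.mul_assoc]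
    · change A = P * (Pᵀ * S * A * P) * (Pᵀ * S)
      calc A = (P * (Pᵀ * S)) * A * (P * (Pᵀ * S)) := by rw [hP']; simp
        _ = _ := by simp only [Matrix.mul_assoc]
end

section
/- Let K be an algebraically closed field. For every positive integer d there exists B ∈ M_{d×(d+1)}(K) such that both B·Bᵀ and Bᵀ·B are nilpotent matrices with a single Jordan block (i.e., (BBᵀ)^{d-1} ≠ 0 and (BᵀB)^d ≠ 0). -/
open Matrix

/-- Truncated Hankel array. -/
def hk {K : Type*} [Zero K] (d e : ℕ) (x : ℕ → K) (k : ℕ) : Matrix (Fin k) (Fin k) K :=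
  Matrix.of fun i j => if (i : ℕ) + j + e ≤ d then x (i + j + e) else 0

theorem anti_det {K : Type*} [Field K] (k : ℕ) :
    (Matrix.of fun i j : Fin k => if (i : ℕ) + j + 1 = k then (1 : K) else 0).det ≠ 0 := by
  have h : (Matrix.of fun i j : Fin k => if (i : ℕ) + j + 1 = k then (1 : K) else 0)
      = (1 : Matrix (Fin k) (Fin k) K).submatrix Fin.revPerm id := by
    ext i j
    simp only [Matrix.of_apply, Matrix.submatrix_apply, Matrix.one_apply, Fin.revPerm_apply, id]
    congr 1
    rw [Fin.ext_iff, Fin.val_rev]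
    apply propext
    omega
  rw [h, Matrix.det_permute]
  simp only [Matrix.det_one, mul_one]
  rcases Int.units_eq_one_or (Equiv.Perm.sign (Fin.revPerm : Equiv.Perm (Fin k))) with h | h <;>
    simp [h]

theorem hk_poly_ne {K : Type*} [Field K] (d e k : ℕ) (hk' : k + e ≤ d + 1) :
    (hk d e (fun m => (MvPolynomial.X m : MvPolynomial ℕ K)) k).det ≠ 0 := by
  intro h
  have h2 := congrArg (MvPolynomial.eval (fun m => if m + 1 = k + e then (1 : K) else 0)) h
  rw [RingHom.map_det, map_zero] at h2
  refine anti_det (K := K) k (Eq.trans ?_ h2)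
  congr 1
  ext i j
  simp only [hk, RingHom.mapMatrix_apply, Matrix.map_apply, Matrix.of_apply]
  by_cases h1 : (i : ℕ) + j + e ≤ d
  · simp only [h1, if_true, MvPolynomial.eval_X]
    congr 1
    apply propext
    omega
  · rw [if_neg h1, map_zero, if_neg (by omega)]

theorem exists_good {K : Type*} [Field K] [Infinite K] (d : ℕ) :
    ∃ x : ℕ → K, (∀ k ≤ d, (hk d 1 x k).det ≠ 0) ∧ ∀ k ≤ d + 1, (hk d 0 x k).det ≠ 0 := by
  set p : ℕ → ℕ → MvPolynomial ℕ K := fun e k =>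
    (hk d e (fun m => (MvPolynomial.X m : MvPolynomial ℕ K)) k).det with hp
  have key : (∏ k ∈ Finset.range (d + 1), p 1 k) * ∏ k ∈ Finset.range (d + 2), p 0 k ≠ 0 := by
    apply mul_ne_zero <;> rw [Finset.prod_ne_zero_iff] <;> intro k hk' <;>
      rw [Finset.mem_range] at hk' <;> apply hk_poly_ne <;> omega
  have : ∃ x : ℕ → K, MvPolynomial.eval x
      ((∏ k ∈ Finset.range (d + 1), p 1 k) * ∏ k ∈ Finset.range (d + 2), p 0 k) ≠ 0 := by
    by_contra! hc
    exact key (MvPolynomial.funext (fun x => by rw [hc x, map_zero]))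
  obtain ⟨x, hx⟩ := this
  have ev : ∀ e k, MvPolynomial.eval x (p e k) = (hk d e x k).det := by
    intro e k
    rw [hp, RingHom.map_det]
    congr 1
    ext i j
    simp only [hk, RingHom.mapMatrix_apply, Matrix.map_apply, Matrix.of_apply]
    split_ifs <;> simp
  simp only [map_mul, map_prod, ev] at hx
  have h1 := left_ne_zero_of_mul hx
  have h2 := right_ne_zero_of_mul hx
  rw [Finset.prod_ne_zero_iff] at h1 h2
  exact ⟨x, fun k hk' => h1 k (by simp; omega), fun k hk' => h2 k (by simp; omega)⟩

theorem chol {K : Type*} [Field K] [IsAlgClosed K] (s : ℕ → ℕ → K) (hs : ∀ i j, s i j = s j i)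
    (n : ℕ) (h : ∀ k ≤ n, (Matrix.of fun i j : Fin k => s i j).det ≠ 0) :
    ∃ P : Matrix (Fin n) (Fin n) K, P * Pᵀ = Matrix.of fun i j : Fin n => s i j := by
  induction n with
  | zero => exact ⟨0, by ext i; exact i.elim0⟩
  | succ n ih =>
    obtain ⟨P, hP⟩ := ih (fun k hk => h k (by omega))
    have hu : IsUnit P.det := by
      have := h n (by omega)
      rw [← hP, Matrix.det_mul] at this
      exact (left_ne_zero_of_mul this).isUnit
    set b : Fin n → K := fun i => s i n with hb
    set x := P⁻¹ *ᵥ b with hx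
    have hPx : P *ᵥ x = b := by
      rw [hx, Matrix.mulVec_mulVec, Matrix.mul_nonsing_inv _ hu, Matrix.one_mulVec]
    obtain ⟨y, hy⟩ := IsAlgClosed.exists_pow_nat_eq (s n n - x ⬝ᵥ x) (n := 2) (by norm_num)
    refine ⟨Matrix.of fun i j => Fin.lastCases (motive := fun _ => K)
      (Fin.lastCases (motive := fun _ => K) y x j)
      (fun i => Fin.lastCases (motive := fun _ => K) 0 (P i) j) i, ?_⟩
    have hPx' : ∀ i, ∑ k, P i k * x k = s i n := fun i => congrFun hPx i
    ext i j
    rw [Matrix.mul_apply, Fin.sum_univ_castSucc]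
    induction i using Fin.lastCases with
    | last =>
      induction j using Fin.lastCases with
      | last =>
        simp only [Matrix.of_apply, Matrix.transpose_apply, Fin.lastCases_last,
          Fin.lastCases_castSucc, Fin.val_last]
        rw [← pow_two, hy, dotProduct]; ring
      | cast j =>
        simp only [Matrix.of_apply, Matrix.transpose_apply, Fin.lastCases_last,
          Fin.lastCases_castSucc, Fin.val_last, Fin.val_castSucc]
        rw [hs, ← hPx' j]
        simp [mul_comm]
    | cast i =>
      induction j using Fin.lastCases with
      | last =>
        simp only [Matrix.of_apply, Matrix.transpose_apply, Fin.lastCases_last,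
          Fin.lastCases_castSucc, Fin.val_last, Fin.val_castSucc]
        rw [← hPx' i]
        simp
      | cast j =>
        simp only [Matrix.of_apply, Matrix.transpose_apply, 
          Fin.lastCases_last, Fin.lastCases_castSucc, Fin.val_castSucc]
        have := congrFun (congrFun hP i) j
        rw [Matrix.mul_apply] at this
        simpa using this

/-- Shift matrix. -/
def sh (K : Type*) [Field K] (m n e : ℕ) : Matrix (Fin m) (Fin n) K :=
  Matrix.of fun i j => if (i : ℕ) = j + e then 1 else 0

theorem sh_mul {K : Type*} [Field K] (m n p e f : ℕ) (h : p + f ≤ n ∨ m ≤ n + e) :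
    sh K m n e * sh K n p f = sh K m p (e + f) := by
  ext i j
  simp only [sh, Matrix.mul_apply, Matrix.of_apply]
  by_cases hj : (j : ℕ) + f < n
  · rw [Finset.sum_eq_single ⟨j + f, hj⟩]
    · simp [add_assoc, add_comm e f]
    · intro b _ hb
      have : (b : ℕ) ≠ j + f := fun h => hb (Fin.ext h)
      simp [this]
    · simp
  · rw [Finset.sum_eq_zero]
    · rw [if_neg]; omega
    · intro b _
      have : (b : ℕ) ≠ j + f := by omega
      simp [this]

theorem sh_pow {K : Type*} [Field K] (n k : ℕ) : (sh K n n 1) ^ k = sh K n n k := by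
  induction k with
  | zero => ext i j; simp [sh, Matrix.one_apply, Fin.ext_iff]
  | succ k ih => rw [pow_succ, ih, sh_mul _ _ _ _ _ (by omega)]

theorem conj_sh {K : Type*} [Field K] (n : ℕ) (hn : 0 < n) (A R : Matrix (Fin n) (Fin n) K)
    (hR : IsUnit R.det) (h : A * R = R * sh K n n 1) :
    IsNilpotent A ∧ A ^ (n - 1) ≠ 0 := by
  have hp : ∀ k, A ^ k * R = R * sh K n n k := by
    intro k
    rw [← sh_pow]
    have : SemiconjBy R (sh K n n 1) A := h.symm
    exact (this.pow_right k).symm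
  have hRu : IsUnit R := (Matrix.isUnit_iff_isUnit_det R).2 hR
  refine ⟨⟨n, ?_⟩, fun h0 => ?_⟩
  · have := hp n
    have h0 : sh K n n n = 0 := by
      ext i j
      simp only [sh, Matrix.of_apply, Matrix.zero_apply]
      rw [if_neg]; omega
    rw [h0, mul_zero] at this
    exact (hRu.mul_left_eq_zero).1 this
  · have := hp (n - 1)
    rw [h0, zero_mul] at this
    have h1 := (hRu.mul_right_eq_zero).1 this.symm
    have h2 := congrFun (congrFun h1 ⟨n - 1, by omega⟩) ⟨0, hn⟩
    simp [sh] at h2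

/-- Over an algebraically closed field `K` there is a `d × (d+1)` matrix `B`
such that `BBᵀ` and `BᵀB` are nilpotent with a single Jordan block. -/
theorem stmt9 (K : Type*) [Field K] [IsAlgClosed K] (d : ℕ) (hd : 0 < d) :
    ∃ B : Matrix (Fin d) (Fin (d + 1)) K,
      IsNilpotent (B * Bᵀ) ∧ (B * Bᵀ) ^ (d - 1) ≠ 0 ∧
      IsNilpotent (Bᵀ * B) ∧ (Bᵀ * B) ^ d ≠ 0 := by
  have : Infinite K := IsAlgClosed.instInfinite
  obtain ⟨x, h1, h0⟩ := exists_good (K := K) d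
  obtain ⟨P, hP⟩ := chol (fun i j => if i + j + 1 ≤ d then x (i + j + 1) else 0)
    (fun i j => by simp only [add_comm i j]) d h1
  obtain ⟨Q, hQ⟩ := chol (fun i j => if i + j + 0 ≤ d then x (i + j + 0) else 0)
    (fun i j => by simp only [add_comm i j]) (d + 1) h0
  have hPu : IsUnit P.det := by
    have := h1 d le_rfl
    rw [hk, ← hP, Matrix.det_mul] at this
    exact (left_ne_zero_of_mul this).isUnit
  have hQu : IsUnit Q.det := by
    have := h0 (d + 1) le_rfl
    rw [hk, ← hQ, Matrix.det_mul] at this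
    exact (left_ne_zero_of_mul this).isUnit
  have hPt : IsUnit Pᵀ.det := by rwa [Matrix.det_transpose]
  have hQt : IsUnit Qᵀ.det := by rwa [Matrix.det_transpose]
  have hN : (sh K d (d + 1) 0)ᵀ * (P * Pᵀ) = Q * Qᵀ * sh K (d + 1) d 1 := by
    rw [hP, hQ]
    ext i j
    simp only [Matrix.mul_apply, Matrix.transpose_apply, sh, Matrix.of_apply]
    rw [Finset.sum_eq_single (j.succ : Fin (d + 1))
      (fun b _ hb => by
        have : (b : ℕ) ≠ j + 1 := fun h => hb (Fin.ext h)
        simp [this]) (by simp)]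
    by_cases hi : (i : ℕ) < d
    · rw [Finset.sum_eq_single (⟨i, hi⟩ : Fin d)
        (fun b _ hb => by
          have : (b : ℕ) ≠ i := fun h => hb (Fin.ext h)
          simp [this]) (by simp)]
      simp [add_assoc]
    · rw [Finset.sum_eq_zero (fun b _ => by
        have : (b : ℕ) ≠ i := by omega
        simp [this])]
      simp only [Fin.val_succ]
      rw [if_neg (by omega), zero_mul]
  set N := sh K d (d + 1) 0 with hNdef
  have e1 : (Pᵀ * N * Qᵀ⁻¹) * Qᵀ = Pᵀ * N := by
    rw [Matrix.mul_assoc, Matrix.nonsing_inv_mul _ hQt, Matrix.mul_one]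
  have e2 : (Pᵀ * N * Qᵀ⁻¹)ᵀ * Pᵀ = Qᵀ * sh K (d + 1) d 1 := by
    have : (Pᵀ * N * Qᵀ⁻¹)ᵀ = Q⁻¹ * (Nᵀ * P) := by
      simp [Matrix.transpose_mul, Matrix.transpose_nonsing_inv]
    rw [this, Matrix.mul_assoc, Matrix.mul_assoc, hN, Matrix.mul_assoc, ← Matrix.mul_assoc,
      Matrix.nonsing_inv_mul _ hQu, Matrix.one_mul]
  set B := Pᵀ * N * Qᵀ⁻¹ with hB
  have a1 := conj_sh d hd (B * Bᵀ) Pᵀ hPt (by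
    rw [Matrix.mul_assoc, e2, ← Matrix.mul_assoc, e1, Matrix.mul_assoc, hNdef,
      sh_mul _ _ _ _ _ (by omega)])
  have a2 := conj_sh (d + 1) (by omega) (Bᵀ * B) Qᵀ hQt (by
    rw [Matrix.mul_assoc, e1, ← Matrix.mul_assoc, e2, Matrix.mul_assoc, hNdef,
      sh_mul _ _ _ _ _ (by omega)])
  exact ⟨B, a1.1, a1.2, a2.1, a2.2⟩
end

section
/- Let F = F_{q^2} with involution x ↦ x^q. For every B ∈ GL_n(F_q) ⊆ GL_n(F), there exists T ∈ GL_n(F_{q^2}) such that T*·T is similar to B over F_{q^2}. -/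
open Matrix

namespace Aux

open Polynomial in
lemma exists_functional {K : Type*} [Field K] (g : K[X]) (hg : g ≠ 0) :
    ∃ l : K[X] →ₗ[K] K, (∀ p, g ∣ p → l p = 0) ∧
      ∀ a, (∀ b, l (a * b) = 0) → g ∣ a := by
  have hm : (g * C (g.leadingCoeff)⁻¹).Monic := monic_mul_leadingCoeff_inv hg
  have hu : IsUnit (C (g.leadingCoeff)⁻¹) := by
    rw [isUnit_C]; simpa using hg
  set m := g * C (g.leadingCoeff)⁻¹ with hmdef
  have hdvd : ∀ p, m ∣ p ↔ g ∣ p := fun p => hu.mul_right_dvd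
  refine ⟨(lcoeff K (m.natDegree - 1)).comp (modByMonicHom m), ?_, ?_⟩
  · intro p hp
    have : p %ₘ m = 0 := (modByMonic_eq_zero_iff_dvd hm).2 ((hdvd p).2 hp)
    simp [modByMonicHom, this]
  · intro a h
    rw [← hdvd, ← modByMonic_eq_zero_iff_dvd hm]
    by_contra hr
    set r := a %ₘ m with hrdef
    have hm1 : m ≠ 1 := by
      intro h1
      apply hr
      rw [hrdef, h1, modByMonic_one]
    have hlt : r.natDegree < m.natDegree := natDegree_modByMonic_lt a hm hm1
    have h2 := h (X ^ (m.natDegree - 1 - r.natDegree))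
    have h3 : (a * X ^ (m.natDegree - 1 - r.natDegree)) %ₘ m
        = r * X ^ (m.natDegree - 1 - r.natDegree) := by
      have h4 : a * X ^ (m.natDegree - 1 - r.natDegree)
        = r * X ^ (m.natDegree - 1 - r.natDegree)
          + m * ((a /ₘ m) * X ^ (m.natDegree - 1 - r.natDegree)) := by
        conv_lhs => rw [← modByMonic_add_div a m]
        ring
      rw [h4, add_modByMonic, (modByMonic_eq_zero_iff_dvd hm).2 (Dvd.intro _ rfl), add_zero,
        modByMonic_eq_self_iff hm]
      apply degree_lt_degree
      rw [natDegree_mul_X_pow (hp := hr)]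
      omega
    simp only [LinearMap.comp_apply, modByMonicHom, LinearMap.coe_mk, AddHom.coe_mk, h3,
      lcoeff_apply] at h2
    have h5 : m.natDegree - 1 = r.natDegree + (m.natDegree - 1 - r.natDegree) := by omega
    have h6 : (r * X ^ (m.natDegree - 1 - r.natDegree)).coeff
        (r.natDegree + (m.natDegree - 1 - r.natDegree)) = r.coeff r.natDegree :=
      coeff_mul_X_pow _ _ _
    rw [← h5, h2] at h6
    exact hr (leadingCoeff_eq_zero.1 h6.symm)

open Polynomial in
lemma exists_quot_functional {K : Type*} [Field K] (g : K[X]) (hg : g ≠ 0) :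
    ∃ l : (K[X] ⧸ Ideal.span {g}) →ₗ[K] K, ∀ a, (∀ b, l (a * b) = 0) → a = 0 := by
  obtain ⟨l, h1, h2⟩ := exists_functional g hg
  refine ⟨((Ideal.span {g}).restrictScalars K).liftQ l ?_, ?_⟩
  · intro p hp
    exact h1 p (Ideal.mem_span_singleton.1 hp)
  · intro a h
    obtain ⟨a, rfl⟩ := Ideal.Quotient.mk_surjective a
    rw [Ideal.Quotient.eq_zero_iff_mem, Ideal.mem_span_singleton]
    apply h2
    intro b
    exact h (Ideal.Quotient.mk _ b)

open Polynomial in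
lemma exists_form {K V : Type*} [Field K] [AddCommGroup V] [Module K V] [FiniteDimensional K V]
    (f : Module.End K V) :
    ∃ β : V →ₗ[K] V →ₗ[K] K, (∀ x y, β x y = β y x) ∧ (∀ x y, β (f x) y = β x (f y)) ∧
      ∀ x, (∀ y, β x y = 0) → x = 0 := by
  classical
  have ht : Module.IsTorsion K[X] (Module.AEval' f) := Module.AEval.isTorsion_of_finiteDimensional K V f
  obtain ⟨ι, _, p, hp, e, ⟨E⟩⟩ := Module.equiv_directSum_of_isTorsion ht
  choose l hl using fun i => exists_quot_functional (p i ^ e i) (pow_ne_zero _ (hp i).ne_zero)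
  let c : ∀ i, V →ₗ[K] (K[X] ⧸ Ideal.span {p i ^ e i}) := fun i =>
    ((DirectSum.component K[X] ι (fun i => K[X] ⧸ Ideal.span {p i ^ e i}) i).restrictScalars K) ∘ₗ
      (E.toLinearMap.restrictScalars K) ∘ₗ (Module.AEval'.of f).toLinearMap
  have hc : ∀ i x, c i x = E (Module.AEval'.of f x) i := fun i x => rfl
  have hf : ∀ i x, c i (f x) = Ideal.Quotient.mk _ X * c i x := by
    intro i x
    rw [hc, hc, ← Module.AEval'.X_smul_of, map_smul]
    rfl
  let β : V →ₗ[K] V →ₗ[K] K :=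
    ∑ i, ((LinearMap.mul K _).compr₂ (l i)).compl₁₂ (c i) (c i)
  have hβ : ∀ x y, β x y = ∑ i, l i (c i x * c i y) := by
    intro x y
    simp only [β, LinearMap.sum_apply, LinearMap.compl₁₂_apply, LinearMap.compr₂_apply,
      LinearMap.mul_apply']
  have hsurj : ∀ i b, ∃ y, c i y = b ∧ ∀ j, j ≠ i → c j y = 0 := by
    intro i b
    refine ⟨(Module.AEval'.of f).symm (E.symm (DirectSum.of _ i b)), ?_, fun j hj => ?_⟩
    · rw [hc, LinearEquiv.apply_symm_apply, LinearEquiv.apply_symm_apply, DirectSum.of_eq_same]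
    · rw [hc, LinearEquiv.apply_symm_apply, LinearEquiv.apply_symm_apply,
        DirectSum.of_eq_of_ne _ _ _ hj]
  have hinj : ∀ x, (∀ i, c i x = 0) → x = 0 := by
    intro x h
    have h0 : E (Module.AEval'.of f x) = 0 := DFinsupp.ext fun i => h i
    rw [LinearEquiv.map_eq_zero_iff, LinearEquiv.map_eq_zero_iff] at h0
    exact h0
  clear_value c β
  refine ⟨β, ?_, ?_, ?_⟩
  · intro x y
    rw [hβ, hβ]
    exact Finset.sum_congr rfl fun i _ => by rw [mul_comm]
  · intro x y
    rw [hβ, hβ]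
    refine Finset.sum_congr rfl fun i _ => ?_
    rw [hf, hf, mul_assoc, mul_left_comm]
  · intro x h
    refine hinj x fun i => hl i _ fun b => ?_
    obtain ⟨y, hy1, hy2⟩ := hsurj i b
    have h1 := h y
    rw [hβ, Finset.sum_eq_single i, hy1] at h1
    · exact h1
    · intro j _ hj
      rw [hy2 j hj, mul_zero, map_zero]
    · exact fun hi => absurd (Finset.mem_univ i) hi

lemma exists_symm {K : Type*} [Field K] {n : ℕ} (B : Matrix (Fin n) (Fin n) K) :
    ∃ S : Matrix (Fin n) (Fin n) K, IsUnit S ∧ Sᵀ = S ∧ S * B = Bᵀ * S := by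
  obtain ⟨β, h1, h2, h3⟩ := exists_form (Matrix.toLin' B)
  have key : ∀ x y, β x y = x ⬝ᵥ (LinearMap.toMatrix₂' K β) *ᵥ y := by
    intro x y
    rw [← Matrix.toLinearMap₂'_apply', Matrix.toLinearMap₂'_toMatrix']
  refine ⟨LinearMap.toMatrix₂' K β, ?_, ?_, ?_⟩
  · rw [← Matrix.isUnit_transpose, ← Matrix.mulVec_injective_iff_isUnit]
    refine (injective_iff_map_eq_zero (Matrix.mulVecLin (LinearMap.toMatrix₂' K β)ᵀ)).2 ?_
    intro x hx
    apply h3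
    intro y
    have hx' : (LinearMap.toMatrix₂' K β)ᵀ *ᵥ x = 0 := hx
    rw [key, Matrix.dotProduct_mulVec, ← Matrix.mulVec_transpose, hx', zero_dotProduct]
  · ext i j
    simp [LinearMap.toMatrix₂'_apply, h1]
  · have e1 := LinearMap.toMatrix₂'_compl₁₂ (R := K) β (Matrix.toLin' B) LinearMap.id
    have e2 := LinearMap.toMatrix₂'_compl₁₂ (R := K) β LinearMap.id (Matrix.toLin' B)
    have : β.compl₁₂ (Matrix.toLin' B) LinearMap.id = β.compl₁₂ LinearMap.id (Matrix.toLin' B) := by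
      ext x y
      simp only [LinearMap.compl₁₂_apply, LinearMap.comp_apply, LinearMap.id_apply, h2]
    rw [this, e2] at e1
    simpa using e1

section herm

variable {F : Type*} [Field F] [StarRing F] {n : ℕ}

lemma exists_orthonormal
    (hN : ∀ a : F, star a = a → a ≠ 0 → ∃ c, star c * c = a)
    (hT : ∃ c : F, c + star c ≠ 0) (H : Matrix (Fin n) (Fin n) F) (hH : Hᴴ = H) (hu : IsUnit H)
    (k : ℕ) (hk : k ≤ n) :
    ∃ v : Fin k → Fin n → F, ∀ i j, star (v i) ⬝ᵥ H *ᵥ v j = if i = j then 1 else 0 := by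
  have hsymm : ∀ x y : Fin n → F, star (star x ⬝ᵥ H *ᵥ y) = star y ⬝ᵥ H *ᵥ x := by
    intro x y
    rw [Matrix.star_dotProduct, star_star, Matrix.star_mulVec, hH, ← Matrix.dotProduct_mulVec]
  induction k with
  | zero => exact ⟨fun i => i.elim0, fun i => i.elim0⟩
  | succ k ih =>
    obtain ⟨v, hv⟩ := ih (by omega)
    -- a nonisotropic vector orthogonal to all
    have hw : ∃ w : Fin n → F, (∀ i, star (v i) ⬝ᵥ H *ᵥ w = 0) ∧ star w ⬝ᵥ H *ᵥ w ≠ 0 := by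
      by_contra! hcon
      let L : (Fin n → F) →ₗ[F] (Fin k → F) :=
        Matrix.mulVecLin ((Matrix.of fun i => star (v i)) * H)
      have hL : ∀ x i, L x i = star (v i) ⬝ᵥ H *ᵥ x := by
        intro x i
        simp only [L, Matrix.mulVecLin_apply, ← Matrix.mulVec_mulVec]
        rfl
      have hker : LinearMap.ker L ≠ ⊥ := by
        apply LinearMap.ker_ne_bot_of_finrank_lt
        simp; omega
      obtain ⟨w, hwk, hw0⟩ := Submodule.exists_mem_ne_zero_of_ne_bot hker
      have hw1 : ∀ i, star (v i) ⬝ᵥ H *ᵥ w = 0 := by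
        intro i
        rw [← hL, LinearMap.mem_ker.1 hwk]; rfl
      have hiso : ∀ u, (∀ i, star (v i) ⬝ᵥ H *ᵥ u = 0) → star w ⬝ᵥ H *ᵥ u = 0 := by
        intro u hu1
        by_contra hne
        obtain ⟨c, hc⟩ := hT
        set d := c / (star w ⬝ᵥ H *ᵥ u) with hd
        have h1 := hcon (w + d • u) (by
          intro i
          rw [Matrix.mulVec_add, Matrix.mulVec_smul, dotProduct_add, dotProduct_smul, hw1, hu1]
          simp)
        have h2 := hcon w hw1
        have h3 := hcon u hu1
        simp only [Matrix.mulVec_add, Matrix.mulVec_smul, dotProduct_add, dotProduct_smul,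
          star_add, star_smul, add_dotProduct, smul_dotProduct, h2, h3, ← hsymm w u,
          smul_eq_mul] at h1
        apply hc
        have h4 : d * (star w ⬝ᵥ H *ᵥ u) = c := by rw [hd]; field_simp
        rw [← h4, star_mul']
        simpa [add_comm] using h1
      have hall : ∀ x, star w ⬝ᵥ H *ᵥ x = 0 := by
        intro x
        have hvw : ∀ i, star w ⬝ᵥ H *ᵥ v i = 0 := by
          intro i; rw [← hsymm, hw1, star_zero]
        have h1 := hiso (x - ∑ i, (star (v i) ⬝ᵥ H *ᵥ x) • v i) (by
          intro i
          simp [Matrix.mulVec_sub, Matrix.mulVec_sum, Matrix.mulVec_smul, dotProduct_sub,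
            dotProduct_sum, dotProduct_smul, hv])
        simpa [Matrix.mulVec_sub, Matrix.mulVec_sum, Matrix.mulVec_smul, dotProduct_sub,
            dotProduct_sum, dotProduct_smul, hvw] using h1
      apply hw0
      have h5 : star w = 0 := by
        apply dotProduct_eq_zero
        intro y
        obtain ⟨x, rfl⟩ := (Matrix.mulVec_surjective_iff_isUnit.2 hu) y
        exact hall x
      simpa using h5
    obtain ⟨w, hw1, hw2⟩ := hw
    obtain ⟨c, hc⟩ := hN _ (hsymm w w) hw2
    have hc0 : c ≠ 0 := by rintro rfl; simp at hc; exact hw2 hc.symm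
    have hw1' : ∀ i, star w ⬝ᵥ H *ᵥ v i = 0 := by
      intro i; rw [← hsymm, hw1, star_zero]
    refine ⟨Fin.cons (c⁻¹ • w) v, fun i j => ?_⟩
    have hsc : star c ≠ 0 := by simpa using hc0
    refine Fin.cases ?_ (fun i => ?_) i <;> refine Fin.cases ?_ (fun j => ?_) j
    · simp only [Fin.cons_zero, star_smul, Matrix.mulVec_smul, dotProduct_smul, smul_dotProduct,
        ← hc, smul_eq_mul, star_inv₀, if_true]
      field_simp
    · simp [hw1', (Fin.succ_ne_zero _).symm]
    · simp [Matrix.mulVec_smul, hw1]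
    · simp [hv]

lemma exists_factor
    (hN : ∀ a : F, star a = a → a ≠ 0 → ∃ c, star c * c = a)
    (hT : ∃ c : F, c + star c ≠ 0) (H : Matrix (Fin n) (Fin n) F) (hH : Hᴴ = H) (hu : IsUnit H) :
    ∃ T : Matrix (Fin n) (Fin n) F, IsUnit T ∧ Tᴴ * T = H := by
  obtain ⟨v, hv⟩ := exists_orthonormal hN hT H hH hu n le_rfl
  let M : Matrix (Fin n) (Fin n) F := (Matrix.of v)ᵀ
  have hM : Mᴴ * (H * M) = 1 := by
    ext i j
    rw [Matrix.one_apply, ← hv i j]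
    rfl
  have hM' : (Mᴴ * H) * M = 1 := by rw [Matrix.mul_assoc, hM]
  have hM2 : M * (Mᴴ * H) = 1 := mul_eq_one_comm.1 hM'
  refine ⟨Mᴴ * H, IsUnit.of_mul_eq_one _ hM', ?_⟩
  rw [Matrix.conjTranspose_mul, hH, Matrix.conjTranspose_conjTranspose, Matrix.mul_assoc, hM2,
    Matrix.mul_one]

lemma main
    (hN : ∀ a : F, star a = a → a ≠ 0 → ∃ c, star c * c = a)
    (hT : ∃ c : F, c + star c ≠ 0) (S B : Matrix (Fin n) (Fin n) F)
    (hS : Sᴴ = S) (hu : IsUnit S) (hSB : S * B = Bᴴ * S) (hB : IsUnit B) :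
    ∃ T : Matrix (Fin n) (Fin n) F, IsUnit T ∧
      ∃ P : (Matrix (Fin n) (Fin n) F)ˣ, Tᴴ * T = P.val * B * P⁻¹.val := by
  obtain ⟨R, ⟨P, rfl⟩, hR⟩ := exists_factor hN hT S hS hu
  obtain ⟨T, hT1, hT2⟩ := exists_factor hN hT (P.val * B * P⁻¹.val) (by
    have h1 : (P⁻¹.val)ᴴ * P.valᴴ = 1 := by
      rw [← Matrix.conjTranspose_mul, P.mul_inv, Matrix.conjTranspose_one]
    rw [Matrix.conjTranspose_mul, Matrix.conjTranspose_mul]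
    calc (P⁻¹.val)ᴴ * (Bᴴ * P.valᴴ) = (P⁻¹.val)ᴴ * (Bᴴ * (P.valᴴ * P.val)) * P⁻¹.val := by
          simp only [Matrix.mul_assoc, P.mul_inv, Matrix.mul_one]
      _ = (P⁻¹.val)ᴴ * P.valᴴ * (P.val * B) * P⁻¹.val := by
          rw [hR, ← hSB, ← hR]; simp only [Matrix.mul_assoc]
      _ = _ := by rw [h1, Matrix.one_mul]) ((P.isUnit.mul hB).mul P⁻¹.isUnit)
  exact ⟨T, hT1, P, hT2⟩

end herm

end Aux

/-- Every invertible matrix `B` with entries in `𝔽_q` is similar over `𝔽_{q²}`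
to `T*·T` for some invertible `T` over `𝔽_{q²}`. -/
theorem stmt14 (F : Type*) [Field F] [Fintype F] (q n : ℕ)
    (hq : Fintype.card F = q ^ 2)
    (B : Matrix (Fin n) (Fin n) F) (hB : ∀ i j, (B i j) ^ q = B i j)
    (hBunit : IsUnit B) :
    ∃ T : Matrix (Fin n) (Fin n) F, IsUnit T ∧
      ∃ P : (Matrix (Fin n) (Fin n) F)ˣ,
        (T.map (· ^ q))ᵀ * T = P.val * B * P⁻¹.val := by
  classical
  have hq2 : 2 ≤ q := by
    have := Fintype.one_lt_card (α := F)
    rw [hq] at this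
    by_contra! h
    interval_cases q <;> simp at this
  obtain ⟨p, hchar⟩ := CharP.exists F
  obtain ⟨m, hp, hm⟩ := FiniteField.card F p
  have := Fact.mk hp
  obtain ⟨k, -, hk⟩ : ∃ k ≤ (m : ℕ), q = p ^ k :=
    (Nat.dvd_prime_pow hp).1 (by rw [← hm, hq]; exact dvd_pow_self q two_ne_zero)
  let σ : F →+* F := iterateFrobenius F p k
  have hσ : ∀ x, σ x = x ^ q := by
    intro x; rw [hk]; exact iterateFrobenius_def p k x
  have hσσ : ∀ x, σ (σ x) = x := by
    intro x
    rw [hσ, hσ, ← pow_mul, ← sq, ← hq, FiniteField.pow_card]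
  let _ : StarRing F :=
    { star := σ
      star_involutive := hσσ
      star_mul := fun x y => by
        change σ (x * y) = σ y * σ x
        rw [map_mul, mul_comm]
      star_add := map_add σ }
  have hstar : ∀ x : F, star x = x ^ q := hσ
  obtain ⟨g, hg⟩ := IsCyclic.exists_generator (α := Fˣ)
  have hord : orderOf g = (q + 1) * (q - 1) := by
    rw [orderOf_eq_card_of_forall_mem_zpowers hg, Nat.card_eq_fintype_card, Fintype.card_units, hq]
    have := Nat.sq_sub_sq q 1
    simpa using this
  have hq1 : 0 < q - 1 := by omega
  have hN : ∀ a : F, star a = a → a ≠ 0 → ∃ c, star c * c = a := by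
    intro a ha ha0
    obtain ⟨j, hj⟩ := (mem_powers_iff_mem_zpowers.2 (hg (Units.mk0 a ha0)))
    have hj' : g ^ j = Units.mk0 a ha0 := hj
    have h1 : (Units.mk0 a ha0) ^ (q - 1) = 1 := by
      ext
      simp only [Units.val_pow_eq_pow_val, Units.val_mk0, Units.val_one]
      rw [hstar] at ha
      have : a ^ (q - 1) * a = 1 * a := by
        rw [← pow_succ, one_mul, Nat.sub_add_cancel (by omega), ha]
      exact mul_right_cancel₀ ha0 this
    rw [← hj', ← pow_mul] at h1
    have h2 := orderOf_dvd_of_pow_eq_one h1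
    rw [hord] at h2
    obtain ⟨t, rfl⟩ := Nat.dvd_of_mul_dvd_mul_right hq1 h2
    refine ⟨(g : F) ^ t, ?_⟩
    have h3 := congrArg Units.val hj'
    simp only [Units.val_pow_eq_pow_val, Units.val_mk0] at h3
    rw [hstar, ← pow_succ, ← pow_mul, ← h3, mul_comm]
  have hT : ∃ c : F, c + star c ≠ 0 := by
    refine ⟨(g : F), fun h => ?_⟩
    rw [hstar] at h
    have h0 : (g : F) ≠ 0 := g.ne_zero
    have h1 : (g : F) ^ (q - 1) = -1 := by
      apply mul_right_cancel₀ h0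
      rw [← pow_succ, Nat.sub_add_cancel (by omega)]
      linear_combination h
    have h2 : g ^ (2 * (q - 1)) = 1 := by
      ext
      rw [Units.val_pow_eq_pow_val, mul_comm, pow_mul, h1]
      simp
    have h3 := orderOf_dvd_of_pow_eq_one h2
    rw [hord] at h3
    have h4 := Nat.le_of_dvd (by norm_num) (Nat.dvd_of_mul_dvd_mul_right hq1 h3)
    omega
  let K : Subfield F := σ.eqLocusField (RingHom.id F)
  have hK : ∀ x, x ∈ K ↔ σ x = x := fun x => Iff.rfl
  let B0 : Matrix (Fin n) (Fin n) K := Matrix.of fun i j => ⟨B i j, by rw [hK, hσ, hB]⟩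
  obtain ⟨S, hS1, hS2, hS3⟩ := Aux.exists_symm B0
  have hBB : B0.map K.subtype = B := by ext i j; rfl
  have hBt : Bᴴ = Bᵀ := by
    ext i j
    simp only [Matrix.conjTranspose_apply, Matrix.transpose_apply, hstar, hB]
  have hmain := Aux.main hN hT (S.map K.subtype) B (by
    ext i j
    rw [Matrix.conjTranspose_apply]
    have h1 : S j i = S i j := congrFun (congrFun hS2 i) j
    rw [Matrix.map_apply, Matrix.map_apply, h1]
    exact (S i j).2) (hS1.map K.subtype.mapMatrix) (by
    rw [hBt, ← hBB, ← Matrix.transpose_map, ← Matrix.map_mul, ← Matrix.map_mul, hS3]) hBunit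
  obtain ⟨T, h1, P, h2⟩ := hmain
  refine ⟨T, h1, P, ?_⟩
  rw [← h2]
  congr 1
  ext i j
  exact (hstar _).symm
end

section
/- Let F = F_{q^2} with involution x ↦ x^q and let T ∈ M_n(F). There exist unitary matrices X, Y ∈ U_n such that S = X T Y* satisfies S*·S = S·S* if and only if T*·T and T·T* are similar matrices. -/
open Matrix

open Polynomial in
/-- The norm form `a² + ab + ν b²` over a finite field is universal if nondegenerate. -/
theorem norm_form_field {K : Type*} [Field K] [Finite K] (ν u : K) (h : 1 - 4 * ν ≠ 0) :
    ∃ a b : K, a ^ 2 + a * b + ν * b ^ 2 = u := by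
  have := Fintype.ofFinite K
  by_cases h2 : ringChar K = 2
  · obtain ⟨a, ha⟩ := FiniteField.isSquare_of_char_two h2 u
    exact ⟨a, 0, by rw [ha]; ring⟩
  · have h2' : (2 : K) ≠ 0 := Ring.two_ne_zero h2
    have hc : ν - 1 / 4 ≠ 0 := by
      intro h0
      apply h
      have h4 : (4 : K) ≠ 0 := by
        have : (4 : K) = 2 * 2 := by norm_num
        rw [this]; exact mul_ne_zero h2' h2'
      field_simp at h0
      linear_combination -h0
    obtain ⟨x, y, hxy⟩ := FiniteField.exists_root_sum_quadratic (f := (X ^ 2 : K[X]))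
      (g := C (ν - 1 / 4) * X ^ 2 + C 0 * X + C (-u)) (degree_X_pow 2)
      (degree_quadratic hc) (FiniteField.odd_card_of_char_ne_two h2)
    refine ⟨x - y / 2, y, ?_⟩
    simp only [eval_add, eval_mul, eval_pow, eval_X, eval_C] at hxy
    have h4 : (4 : K)⁻¹ = 2⁻¹ * 2⁻¹ := by rw [← mul_inv]; norm_num
    have h22 : (2 : K)⁻¹ * 2 = 1 := inv_mul_cancel₀ h2'
    simp only [div_eq_mul_inv, h4] at *
    linear_combination hxy - x * y * h22 + y ^ 2 * 2⁻¹ * h22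

open Polynomial in
/-- The same over a finite commutative ring, for unit values. -/
theorem norm_form_ring {R : Type*} [CommRing R] [Finite R] (ν u : R) (h : IsUnit (1 - 4 * ν))
    (hu : IsUnit u) : ∃ a b : R, a ^ 2 + a * b + ν * b ^ 2 = u := by
  have key : ∀ M : MaximalSpectrum R, ∃ a b : R, a ^ 2 + a * b + ν * b ^ 2 - u ∈ M.asIdeal := by
    intro M
    have := M.isMaximal
    letI := Ideal.Quotient.field M.asIdeal
    have : Finite (R ⧸ M.asIdeal) := Finite.of_surjective _ (Ideal.Quotient.mk_surjective)
    obtain ⟨a, b, hab⟩ := norm_form_field (Ideal.Quotient.mk M.asIdeal ν)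
      (Ideal.Quotient.mk M.asIdeal u) (by
        have := (h.map (Ideal.Quotient.mk M.asIdeal)).ne_zero
        rwa [map_sub, map_one, map_mul, map_ofNat] at this)
    obtain ⟨a, rfl⟩ := Ideal.Quotient.mk_surjective a
    obtain ⟨b, rfl⟩ := Ideal.Quotient.mk_surjective b
    refine ⟨a, b, ?_⟩
    rw [← Ideal.Quotient.eq]
    simpa using hab
  choose fa fb hf using key
  have := Fintype.ofFinite (MaximalSpectrum R)
  have crt : ∀ f : MaximalSpectrum R → R, ∃ x : R, ∀ M : MaximalSpectrum R,
      x - f M ∈ M.asIdeal := by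
    intro f
    obtain ⟨x, hx⟩ := Ideal.exists_forall_sub_mem_ideal
      (I := fun M : MaximalSpectrum R => M.asIdeal) (fun i j hij => by
        have := i.isMaximal
        have := j.isMaximal
        exact Ideal.isCoprime_of_isMaximal (fun h => hij (MaximalSpectrum.ext h))) f
    exact ⟨x, hx⟩
  obtain ⟨a, ha⟩ := crt fa
  obtain ⟨b, hb⟩ := crt fb
  have hnil : IsNilpotent (a ^ 2 + a * b + ν * b ^ 2 - u) := by
    rw [← mem_nilradical, IsArtinianRing.nilradical_eq_iInf, Ideal.mem_iInf]
    intro M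
    have h1 := ha M
    have h2 := hb M
    have h3 := hf M
    rw [← Ideal.Quotient.eq] at h1 h2 h3 ⊢
    rw [← h3]
    simp [h1, h2]
  set w := a ^ 2 + a * b + ν * b ^ 2 with hw
  have hwu : IsUnit w := by
    have := hnil.isUnit_add_left_of_commute hu (Commute.all _ _)
    simpa using this
  obtain ⟨v, hv⟩ := hwu.exists_right_inv
  have hn2 : IsNilpotent (1 - u * v) := by
    have : 1 - u * v = (w - u) * v := by linear_combination -hv
    rw [this]
    exact (Commute.all _ _).isNilpotent_mul_right hnil
  obtain ⟨s, ⟨-, hs⟩, -⟩ := existsUnique_nilpotent_sub_and_aeval_eq_zero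
    (P := (C ν * X ^ 2 + X + C (1 - u * v) : R[X])) (x := (0 : R)) (by simpa using hn2)
    (by simp)
  simp only [map_add, map_mul, aeval_C, aeval_X, map_pow, Algebra.algebraMap_self,
    RingHom.id_apply] at hs
  refine ⟨a - ν * b * s, b + a * s + b * s, ?_⟩
  linear_combination w * hs + u * hv

section
variable {F : Type*} [Field F] [StarRing F] [Finite F] {n : ℕ}

/-- An invertible Hermitian matrix is `Dᴴ D` with `D` in its double centralizer. -/
theorem hermitian_factor (t : F) (ht : t + star t = 1) (ht' : t ≠ star t)
    (H : Matrix (Fin n) (Fin n) F) (hH : Hᴴ = H) (hu : IsUnit H) :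
    ∃ D : Matrix (Fin n) (Fin n) F, Dᴴ * D = H ∧ ∀ B, H * B = B * H → D * B = B * D := by
  set N : Matrix (Fin n) (Fin n) F := scalar (Fin n) (t * star t) with hN
  have hNc : ∀ B, N * B = B * N := fun B =>
    (scalar_commute (t * star t) (fun r => Commute.all _ _) B).eq
  have hNs : ∀ Z, N * Z = (t * star t) • Z := fun Z => by
    rw [hN, scalar_apply, ← smul_one_eq_diagonal, smul_mul_assoc, one_mul]
  have hNh : Nᴴ = N := by
    simp [hN, mul_comm]
  have hcomm : ∀ x ∈ ({H, N} : Set (Matrix (Fin n) (Fin n) F)), ∀ y ∈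
      ({H, N} : Set (Matrix (Fin n) (Fin n) F)), x * y = y * x := by
    rintro x (rfl | rfl) y (rfl | rfl)
    · rfl
    · exact (hNc _).symm
    · exact hNc _
    · rfl
  letI : CommRing (Subring.closure ({H, N} : Set (Matrix (Fin n) (Fin n) F))) :=
    Subring.closureCommRingOfComm hcomm
  have : Finite (Matrix (Fin n) (Fin n) F) := by unfold Matrix; infer_instance
  have hHm : H ∈ Subring.closure ({H, N} : Set (Matrix (Fin n) (Fin n) F)) :=
    Subring.subset_closure (by simp)
  have hNm : N ∈ Subring.closure ({H, N} : Set (Matrix (Fin n) (Fin n) F)) :=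
    Subring.subset_closure (by simp)
  have hcl : ∀ x ∈ Subring.closure ({H, N} : Set (Matrix (Fin n) (Fin n) F)),
      ∀ y ∈ Subring.closure ({H, N} : Set (Matrix (Fin n) (Fin n) F)), x * y = y * x := by
    intro x hx y hy
    exact congrArg Subtype.val (mul_comm (⟨x, hx⟩ :
      Subring.closure ({H, N} : Set (Matrix (Fin n) (Fin n) F))) ⟨y, hy⟩)
  have hher : ∀ x ∈ Subring.closure ({H, N} : Set (Matrix (Fin n) (Fin n) F)), xᴴ = x := by
    intro x hx
    induction hx using Subring.closure_induction with
    | mem x hx =>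
      rcases hx with rfl | rfl
      · exact hH
      · exact hNh
    | zero => simp
    | one => simp
    | add x y _ _ hx hy => rw [conjTranspose_add, hx, hy]
    | neg x _ hx => rw [conjTranspose_neg, hx]
    | mul x y hxm hym hx hy => rw [conjTranspose_mul, hx, hy, hcl y hym x hxm]
  have hcen : ∀ B, H * B = B * H →
      ∀ x ∈ Subring.closure ({H, N} : Set (Matrix (Fin n) (Fin n) F)), x * B = B * x := by
    intro B hB x hx
    induction hx using Subring.closure_induction with
    | mem x hx =>
      rcases hx with rfl | rfl
      · exact hB
      · exact hNc B
    | zero => simp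
    | one => simp
    | add x y _ _ hx hy => rw [add_mul, mul_add, hx, hy]
    | neg x _ hx => rw [neg_mul, mul_neg, hx]
    | mul x y hxm hym hx hy => rw [mul_assoc, hy, ← mul_assoc, hx, mul_assoc]
  have hunit : ∀ x : Subring.closure ({H, N} : Set (Matrix (Fin n) (Fin n) F)),
      IsUnit (x : Matrix (Fin n) (Fin n) F) → IsUnit x := by
    intro x hx
    rw [isUnit_iff_mem_nonZeroDivisors_of_finite, mem_nonZeroDivisors_iff_right]
    intro y hy
    apply Subtype.ext
    have := congrArg Subtype.val hy
    change (y : Matrix (Fin n) (Fin n) F) * x = 0 at this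
    exact hx.mul_left_eq_zero.mp this
  obtain ⟨a, b, hab⟩ := norm_form_ring
    (⟨N, hNm⟩ : Subring.closure ({H, N} : Set (Matrix (Fin n) (Fin n) F))) ⟨H, hHm⟩
    (by
      apply hunit
      change IsUnit ((1 : Matrix (Fin n) (Fin n) F) - 4 * N)
      have : (1 : Matrix (Fin n) (Fin n) F) - 4 * N = scalar (Fin n) ((t - star t) ^ 2) := by
        have h1 : (t - star t) ^ 2 = 1 - 4 * (t * star t) := by
          linear_combination (t + star t + 1) * ht
        rw [h1, map_sub, map_one, map_mul, map_ofNat, hN]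
      rw [this]
      exact (IsUnit.mk0 _ (pow_ne_zero 2 (sub_ne_zero.mpr ht'))).map (scalar (Fin n)))
    (hunit _ hu)
  have hab' : (a : Matrix (Fin n) (Fin n) F) ^ 2 + a * b + N * (b : Matrix (Fin n) (Fin n) F) ^ 2
      = H := congrArg Subtype.val hab
  have hba := hcl b b.2 a a.2
  refine ⟨a + t • (b : Matrix (Fin n) (Fin n) F), ?_, ?_⟩
  · rw [conjTranspose_add, conjTranspose_smul, hher _ a.2, hher _ b.2]
    refine Eq.trans ?_ hab'
    rw [hNs]
    simp only [add_mul, mul_add, smul_mul_assoc, mul_smul_comm, hba, pow_two]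
    have h1 : (a : Matrix (Fin n) (Fin n) F) * b = t • ((a : Matrix (Fin n) (Fin n) F) * b)
        + star t • ((a : Matrix (Fin n) (Fin n) F) * b) := by
      rw [← add_smul, ht, one_smul]
    rw [smul_add, smul_smul]
    nth_rewrite 3 [h1]
    abel
  · intro B hB
    rw [add_mul, mul_add, smul_mul_assoc, mul_smul_comm, hcen B hB _ a.2, hcen B hB _ b.2]

/-- Similar Hermitian matrices are unitarily similar. -/
theorem hermitian_similar (t : F) (ht : t + star t = 1) (ht' : t ≠ star t)
    (A B : Matrix (Fin n) (Fin n) F) (hA : Aᴴ = A) (hB : Bᴴ = B)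
    (P : (Matrix (Fin n) (Fin n) F)ˣ) (hP : A = P.val * B * P⁻¹.val) :
    ∃ U : Matrix (Fin n) (Fin n) F, Uᴴ * U = 1 ∧ A = U * B * Uᴴ := by
  have hAP : A * P.val = P.val * B := by rw [hP]; simp [mul_assoc]
  have hPA : P.valᴴ * A = B * P.valᴴ := by
    have := congrArg conjTranspose hAP
    simpa [hA, hB] using this
  obtain ⟨D, hD, hDc⟩ := hermitian_factor t ht ht' (P.valᴴ * P.val) (by simp)
    ((P.isUnit.star).mul P.isUnit)
  have hDB := hDc B (by rw [mul_assoc, ← hAP, ← mul_assoc, hPA, mul_assoc])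
  have hDu : IsUnit D := by
    have h1 : IsUnit (Dᴴ * D) := by rw [hD]; exact (P.isUnit.star).mul P.isUnit
    rw [isUnit_iff_isUnit_det] at h1 ⊢
    rw [det_mul] at h1
    exact isUnit_of_mul_isUnit_right h1
  obtain ⟨D, rfl⟩ := hDu
  have e1 : (D⁻¹.val)ᴴ * D.valᴴ = 1 := by
    rw [← conjTranspose_mul]; simp
  have hU : (P.val * D⁻¹.val)ᴴ * (P.val * D⁻¹.val) = 1 := by
    rw [conjTranspose_mul]
    calc _ = (D⁻¹.val)ᴴ * (P.valᴴ * P.val) * D⁻¹.val := by simp only [mul_assoc]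
      _ = ((D⁻¹.val)ᴴ * D.valᴴ) * (D.val * D⁻¹.val) := by rw [← hD]; simp only [mul_assoc]
      _ = 1 := by rw [e1]; simp
  refine ⟨P.val * D⁻¹.val, hU, ?_⟩
  have hU' := mul_eq_one_comm.mp hU
  have e2 : D⁻¹.val * B = B * D⁻¹.val := by
    rw [Units.inv_mul_eq_iff_eq_mul, ← mul_assoc, hDB, mul_assoc, Units.mul_inv, mul_one]
  have e3 : P.val * D⁻¹.val * B = A * (P.val * D⁻¹.val) := by
    rw [mul_assoc, e2, ← mul_assoc, ← hAP, mul_assoc]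
  rw [e3, mul_assoc, hU', mul_one]

theorem main_aux (t : F) (ht : t + star t = 1) (ht' : t ≠ star t)
    (T : Matrix (Fin n) (Fin n) F) :
    (∃ X Y S : Matrix (Fin n) (Fin n) F, Xᴴ * X = 1 ∧ Yᴴ * Y = 1 ∧ S = X * T * Yᴴ ∧
        Sᴴ * S = S * Sᴴ) ↔
    (∃ P : (Matrix (Fin n) (Fin n) F)ˣ, Tᴴ * T = P.val * (T * Tᴴ) * P⁻¹.val) := by
  constructor
  · rintro ⟨X, Y, S, hX, hY, rfl, hS⟩
    have hX' := mul_eq_one_comm.mp hX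
    have hY' := mul_eq_one_comm.mp hY
    have c1 : ∀ Z, Xᴴ * (X * Z) = Z := fun Z => by rw [← mul_assoc, hX, one_mul]
    have c2 : ∀ Z, Yᴴ * (Y * Z) = Z := fun Z => by rw [← mul_assoc, hY, one_mul]
    have c3 : ∀ Z, X * (Xᴴ * Z) = Z := fun Z => by rw [← mul_assoc, hX', one_mul]
    have c4 : ∀ Z, Y * (Yᴴ * Z) = Z := fun Z => by rw [← mul_assoc, hY', one_mul]
    refine ⟨⟨Yᴴ * X, Xᴴ * Y, ?_, ?_⟩, ?_⟩
    · simp only [mul_assoc, c3, hY]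
    · simp only [mul_assoc, c4, hX]
    · simp only [conjTranspose_mul, conjTranspose_conjTranspose, mul_assoc, c1, c2] at hS
      have := congrArg (fun Z => Yᴴ * Z * Y) hS
      simp only [mul_assoc, c2, hY, mul_one] at this
      simpa [mul_assoc] using this
  · rintro ⟨P, hP⟩
    obtain ⟨U, hU, h⟩ := hermitian_similar t ht ht' _ _ (by simp) (by simp) P hP
    refine ⟨U, 1, U * T, hU, by simp, by simp, ?_⟩
    have c1 : ∀ Z, Uᴴ * (U * Z) = Z := fun Z => by rw [← mul_assoc, hU, one_mul]
    rw [conjTranspose_mul, mul_assoc, c1, h]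
    simp only [mul_assoc]

end

open Polynomial in
theorem exists_trace_one (F : Type*) [Field F] [Fintype F] (q : ℕ)
    (hq : Fintype.card F = q ^ 2) : ∃ y : F, y + y ^ q ≠ 0 ∧ y ≠ y ^ q := by
  have h1 : 1 < q := by
    have := Fintype.one_lt_card (α := F)
    rw [hq] at this
    by_contra h
    interval_cases q <;> simp at this
  by_contra! hcon
  have d1 : (X ^ q + X : F[X]).natDegree = q := by 
    rw [natDegree_add_eq_left_of_natDegree_lt] <;> simp [h1]
  have d2 : (X ^ (q - 1) - 1 : F[X]).natDegree = q - 1 := by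
    simpa using natDegree_X_pow_sub_C (n := q - 1) (r := (1 : F))
  have n1 : (X ^ q + X : F[X]) ≠ 0 := by intro h; rw [h] at d1; simp at d1; omega
  have n2 : (X ^ (q - 1) - 1 : F[X]) ≠ 0 := by intro h; rw [h] at d2; simp at d2; omega
  have hz : ∀ y : F, ((X ^ q + X) * (X ^ (q - 1) - 1) : F[X]).eval y = 0 := by
    intro y
    simp only [eval_mul, eval_add, eval_sub, eval_pow, eval_X, eval_one]
    by_cases h : y + y ^ q = 0
    · rw [add_comm (y ^ q), h, zero_mul]
    · have hy := hcon y h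
      have hy0 : y ≠ 0 := by
        rintro rfl
        apply h
        rw [zero_pow (by omega), add_zero]
      have : y ^ (q - 1) = 1 := by
        apply mul_left_cancel₀ hy0
        rw [← pow_succ', mul_one, Nat.sub_add_cancel h1.le, ← hy]
      rw [this, sub_self, mul_zero]
  refine mul_ne_zero n1 n2 (eq_zero_of_natDegree_lt_card_of_eval_eq_zero _
    Function.injective_id hz ?_)
  rw [natDegree_mul n1 n2, d1, d2, hq]
  obtain ⟨k, rfl⟩ : ∃ k, q = k + 2 := ⟨q - 2, by omega⟩
  simp only [Nat.add_sub_cancel, show k + 2 - 1 = k + 1 by omega]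
  nlinarith

/-- The `q`-power involution as a star ring structure. -/
theorem add_pow_q (F : Type*) [Field F] [Fintype F] (q : ℕ)
    (hq : Fintype.card F = q ^ 2) (x y : F) : (x + y) ^ q = x ^ q + y ^ q := by
  obtain ⟨p, hp⟩ := CharP.exists F
  obtain ⟨m, hpp, hm⟩ := FiniteField.card F p
  have : Fact p.Prime := ⟨hpp⟩
  have hd : q ∣ p ^ (m : ℕ) := by rw [← hm, hq]; exact dvd_pow_self _ two_ne_zero
  obtain ⟨k, -, rfl⟩ := (Nat.dvd_prime_pow hpp).mp hd
  exact add_pow_char_pow x y p k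

/-- The orbit of `T` under `GU_n(q) × GU_n(q)` (acting by `T ↦ X T Y*`)
contains a normal matrix if and only if `T*T` and `TT*` are similar. -/
theorem stmt15 (F : Type*) [Field F] [Fintype F] (q n : ℕ)
    (hq : Fintype.card F = q ^ 2)
    (T : Matrix (Fin n) (Fin n) F) :
    (∃ X Y S : Matrix (Fin n) (Fin n) F,
        (X.map (· ^ q))ᵀ * X = 1 ∧ (Y.map (· ^ q))ᵀ * Y = 1 ∧
        S = X * T * (Y.map (· ^ q))ᵀ ∧
        (S.map (· ^ q))ᵀ * S = S * (S.map (· ^ q))ᵀ) ↔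
    (∃ P : (Matrix (Fin n) (Fin n) F)ˣ,
        (T.map (· ^ q))ᵀ * T = P.val * (T * (T.map (· ^ q))ᵀ) * P⁻¹.val) := by
  have hinv : ∀ x : F, (x ^ q) ^ q = x := by
    intro x
    rw [← pow_mul, ← pow_two, ← hq, FiniteField.pow_card]
  letI : StarRing F :=
    { star := fun x => x ^ q
      star_involutive := hinv
      star_mul := fun x y => by
        change (x * y) ^ q = y ^ q * x ^ q
        rw [mul_pow, mul_comm]
      star_add := add_pow_q F q hq }
  obtain ⟨y, hy1, hy2⟩ := exists_trace_one F q hq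
  have hc : (y + y ^ q) ^ q = y + y ^ q := by rw [add_pow_q F q hq, hinv, add_comm]
  refine main_aux (y / (y + y ^ q)) ?_ ?_ T
  · change y / (y + y ^ q) + (y / (y + y ^ q)) ^ q = 1
    rw [div_pow, hc, ← add_div, div_self hy1]
  · change y / (y + y ^ q) ≠ (y / (y + y ^ q)) ^ q
    rw [div_pow, hc]
    intro h
    exact hy2 ((div_left_inj' hy1).mp h)
end
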